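/- Let z ∈ I_ℤ and let a ∈ R_inv^+(z) be a primed involution word. Then Des(a) = Des(Q_EGᴼ(a)). -/

import Mathlib

/-! ## Primed letters: the alphabet `ℤ ⊔ ℤ'`, with `i' = i - 1/2`.
A letter is encoded by its "ceiling" together with a flag recording whether it is primed. -/

structure Letter where
  ceil : ℤ
  primed : Bool
deriving DecidableEq, Repr

instance : Inhabited Letter := ⟨⟨0, false⟩⟩

/-- The order `⋯ < 1' < 1 < 2' < 2 < ⋯`. -/
instance : LinearOrder Letter :=
  LinearOrder.lift' (fun x : Letter => toLex (x.ceil, !x.primed))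
    (fun a b h => by
      have h' : (a.ceil, !a.primed) = (b.ceil, !b.primed) := toLex.injective h
      obtain ⟨ac, ap⟩ := a
      obtain ⟨bc, bp⟩ := b
      simp only [Prod.mk.injEq] at h'
      obtain ⟨h1, h2⟩ := h'
      cases ap <;> cases bp <;> simp_all)

/-- A primed word. -/
abbrev PWord := List Letter

def Letter.unprime (x : Letter) : Letter := ⟨x.ceil, false⟩

def Letter.succL (x : Letter) : Letter := ⟨x.ceil + 1, x.primed⟩

/-- `unprime` of a primed word: replace each letter `x` by `⌈x⌉`. -/
def unprimeWord (a : PWord) : List ℤ := a.map Letter.ceil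

/-- `unprime` of a primed word, as a primed word with no primes. -/
def unprimeP (a : PWord) : PWord := a.map Letter.unprime

/-! ## Involution words -/

/-- The simple transposition `s_i = (i, i+1)` of `ℤ`. -/
def sPerm (i : ℤ) : Equiv.Perm ℤ := Equiv.swap i (i + 1)

/-- The Demazure product `s_{w_1} ∘ s_{w_2} ∘ ⋯ ∘ s_{w_k}` of a word, computed by the
defining recursion `σ ∘ s_i = σ·s_i` if `σ(i) < σ(i+1)` and `σ ∘ s_i = σ` otherwise. -/
def heckeProd (w : List ℤ) : Equiv.Perm ℤ :=
  w.foldl (fun σ i => if σ i < σ (i + 1) then σ * sPerm i else σ) 1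

/-- `s_{a_n} ∘ ⋯ ∘ s_{a_2} ∘ s_{a_1} ∘ s_{a_2} ∘ ⋯ ∘ s_{a_n}` for `a = a_1 a_2 ⋯ a_n`. -/
def invHecke (a : List ℤ) : Equiv.Perm ℤ := heckeProd (a.reverse ++ a.tail)

/-- Membership in `I_ℤ`: a finitely supported involution of `ℤ`. -/
def IZ (z : Equiv.Perm ℤ) : Prop := {x : ℤ | z x ≠ x}.Finite ∧ z * z = 1

/-- The set of involution words of `z`. -/
def Rinv (z : Equiv.Perm ℤ) : Set (List ℤ) :=
  {a | invHecke a = z ∧ ∀ b : List ℤ, invHecke b = z → a.length ≤ b.length}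

/-- 0-based index `k` is a commutation in the word `a` (this corresponds to the 1-based
index `k+1`): `a_{k+1}` and `a_{k+1} + 1` are both fixed points of
`s_{a_k} ∘ ⋯ ∘ s_{a_1} ∘ ⋯ ∘ s_{a_k}`. -/
def IsCommutation (a : List ℤ) (k : ℕ) : Prop :=
  ∃ x, a[k]? = some x ∧ invHecke (a.take k) x = x ∧ invHecke (a.take k) (x + 1) = x + 1

/-- The set of primed involution words of `z`. -/
def RinvPlus (z : Equiv.Perm ℤ) : Set PWord :=
  {a | unprimeWord a ∈ Rinv z ∧
     ∀ (k : ℕ) (x : Letter), a[k]? = some x → x.primed = true →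
       IsCommutation (unprimeWord a) k}

/-! ## Shifted tableaux.
A shifted tableau is recorded as its list of rows, from the first (bottom) row upward;
the entry at 0-based index `k` of 0-based row `r` occupies the box in row `r+1` and
column `r+1+k` of the shifted diagram. -/

abbrev STab := List (List Letter)

/-- A strict partition, recorded as its (strictly decreasing) list of positive parts. -/
def IsStrictPartition (sh : List ℕ) : Prop :=
  List.Chain' (fun a b => b < a) sh ∧ ∀ m ∈ sh, 0 < m

def shapeOf {α : Type*} (T : List (List α)) : List ℕ := T.map List.length

/-- The rows form the shifted diagram of a strict partition. -/
def IsShifted {α : Type*} (T : List (List α)) : Prop := IsStrictPartition (shapeOf T)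

/-- The entry of `T` in (0-based) row `r` and column `c` of the shifted diagram. -/
def entryG? {α : Type*} (T : List (List α)) (r c : ℕ) : Option α :=
  if r ≤ c then (T[r]?).bind (fun row => row[c - r]?) else none

def entry? (T : STab) (r c : ℕ) : Option Letter := entryG? T r c

def setRowG {α : Type*} (T : List (List α)) (r : ℕ) (row : List α) : List (List α) :=
  if r < T.length then T.set r row else T ++ [row]

def setEntryG {α : Type*} (T : List (List α)) (r c : ℕ) (x : α) : List (List α) :=
  T.set r ((T.getD r []).set (c - r) x)

def numCols {α : Type*} (T : List (List α)) : ℕ := (T.getD 0 []).length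

/-- Row reading word: rows left to right, starting with the last (top) row. -/
def rowWord (T : STab) : PWord := T.reverse.flatten

/-- Column reading word: columns top to bottom, starting with the first column. -/
def colWord (T : STab) : PWord :=
  (List.range (numCols T)).flatMap (fun c =>
    ((List.range (c + 1)).reverse).filterMap (fun r => entry? T r c))

def unprimeT (T : STab) : STab := T.map (List.map Letter.unprime)

/-- Remove the primes from all main-diagonal entries. -/
def unprimeDiagT (T : STab) : STab :=
  T.map (fun row =>
    match row with
    | [] => []
    | x :: rest => Letter.unprime x :: rest)

/-- Rows and columns are strictly increasing. -/
def IsIncreasing (T : STab) : Prop :=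
  (∀ r c x y, entry? T r c = some x → entry? T r (c + 1) = some y → x < y) ∧
  (∀ r c x y, entry? T r c = some x → entry? T (r + 1) c = some y → x < y)

/-- No primed entries on the main diagonal. -/
def NoDiagPrimes (T : STab) : Prop :=
  ∀ r x, entry? T r r = some x → x.primed = false

/-- Entries positive, rows and columns weakly increasing, no primed entry repeated
in a row and no unprimed entry repeated in a column. -/
def IsSemistandard (T : STab) : Prop :=
  (∀ x ∈ T.flatten, 0 < x.ceil) ∧
  (∀ r c x y, entry? T r c = some x → entry? T r (c + 1) = some y → x ≤ y) ∧
  (∀ r c x y, entry? T r c = some x → entry? T (r + 1) c = some y → x ≤ y) ∧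
  (∀ r c c' x, c < c' → entry? T r c = some x → entry? T r c' = some x →
    x.primed = false) ∧
  (∀ r r' c x, r < r' → entry? T r c = some x → entry? T r' c = some x →
    x.primed = true)

/-- Increasing, with exactly one of `i` or `i'` as an entry for each `i = 1, …, n`,
where `n` is the number of boxes. -/
def IsStandard (T : STab) : Prop :=
  IsIncreasing T ∧
  ∀ i : ℤ, 1 ≤ i → i ≤ (T.flatten.length : ℤ) →
    T.flatten.countP (fun x => decide (x.ceil = i)) = 1
/-! ## Orthogonal Edelman–Greene insertion -/

/-- "Switching the primes" of a pair: reverse the primes on both letters if exactly one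
of them is unprimed, and leave them unchanged otherwise. -/
def switchPrimes (x y : Letter) : Letter × Letter :=
  if x.primed = y.primed then (x, y)
  else (⟨x.ceil, !x.primed⟩, ⟨y.ceil, !y.primed⟩)

/-- Column-insertion stage of orthogonal Edelman–Greene insertion:
insert letter `w` into column `c` of `T` (then continue into later columns). -/
def egCol : ℕ → STab → ℕ → Letter → STab × Bool
  | 0, T, _, _ => (T, true)
  | fuel + 1, T, c, w =>
    let occ := (List.range (c + 1)).filterMap (fun r => (entry? T r c).map (fun x => (r, x)))
    match occ.findIdx? (fun p => decide (w.ceil < p.2.ceil)) with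
    | none =>
        -- place `w` in the first empty box of the column
        let r := occ.length
        let w' := if r = c ∧ w.primed then Letter.unprime w else w
        (setRowG T r ((T.getD r []) ++ [w']), if r = c then w.primed else true)
    | some kM =>
        let km := (occ.findIdx? (fun p => decide (w.ceil ≤ p.2.ceil))).getD kM
        let im := (occ.getD km (0, default)).1
        let m := (occ.getD km (0, default)).2
        if km = kM then
          if im = c then
            -- m = M on the main diagonal
            egCol fuel (setEntryG T im c (Letter.unprime w)) (c + 1) ⟨m.ceil, w.primed⟩
          else
            -- m = M off the main diagonal
            egCol fuel (setEntryG T im c w) (c + 1) m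
        else
          -- m < M : switch the primes on m and M, insert w+1 into the next column
          let iM := (occ.getD kM (0, default)).1
          let M := (occ.getD kM (0, default)).2
          let p := switchPrimes m M
          egCol fuel (setEntryG (setEntryG T im c p.1) iM c p.2) (c + 1) (Letter.succL w)

/-- Row-insertion stage of orthogonal Edelman–Greene insertion:
insert letter `w` into row `r` of `T`. -/
def egRow : ℕ → STab → ℕ → Letter → STab × Bool
  | 0, T, _, _ => (T, true)
  | fuel + 1, T, r, w =>
    let row := T.getD r []
    match row.findIdx? (fun x => decide (w.ceil < x.ceil)) with
    | none =>
        if row.isEmpty ∧ w.primed then (setRowG T r [Letter.unprime w], true)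
        else (setRowG T r (row ++ [w]), false)
    | some kM =>
        let km := (row.findIdx? (fun x => decide (w.ceil ≤ x.ceil))).getD kM
        let m := row.getD km default
        if km = kM then
          if km = 0 then
            -- m = M on the main diagonal
            egCol fuel (setRowG T r (row.set 0 (Letter.unprime w))) (r + 1)
              ⟨m.ceil, w.primed⟩
          else
            -- m = M off the main diagonal
            egRow fuel (setRowG T r (row.set km w)) (r + 1) m
        else
          -- m < M : switch primes; insert w+1 into the next column (if m is on the
          -- main diagonal) or the next row (otherwise)
          let M := row.getD kM default
          let p := switchPrimes m M
          let row' := (row.set km p.1).set kM p.2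
          if km = 0 then egCol fuel (setRowG T r row') (r + 1) (Letter.succL w)
          else egRow fuel (setRowG T r row') (r + 1) (Letter.succL w)

/-- `T ←ᴼ u` together with the flag recording whether the insertion ended in
column insertion. -/
def egInsert (T : STab) (u : Letter) : STab × Bool :=
  egRow (T.flatten.length + T.length + 2) T 0 u

/-- The orthogonal Edelman–Greene insertion tableau `P_EGᴼ(a)`. -/
def PEG (a : PWord) : STab := a.foldl (fun T u => (egInsert T u).1) []

/-- Add the recording letter `x` to `Q` in the unique box of `Pnew` not in `Pold`. -/
def addBox (Q Pold Pnew : STab) (x : Letter) : STab :=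
  match (List.range Pnew.length).find?
      (fun r => decide ((Pold.getD r []).length ≠ (Pnew.getD r []).length)) with
  | some r => setRowG Q r ((Q.getD r []) ++ [x])
  | none => Q

def QEGaux : STab → STab → ℕ → PWord → STab
  | _, Q, _, [] => Q
  | P, Q, n, u :: rest =>
      let res := egInsert P u
      QEGaux res.1 (addBox Q P res.1 ⟨(n : ℤ), res.2⟩) (n + 1) rest

/-- The orthogonal Edelman–Greene recording tableau `Q_EGᴼ(a)`. -/
def QEG (a : PWord) : STab := QEGaux [] [] 1 a

/-! ## Orthogonal Coxeter–Knuth operators -/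

def ock1 (x : Letter) : Letter := ⟨x.ceil, !x.primed⟩

def ock2 (x y : Letter) : Letter × Letter := (⟨y.ceil, x.primed⟩, ⟨x.ceil, y.primed⟩)

def ock3 (x y z : Letter) : Letter × Letter × Letter :=
  if x.ceil = z.ceil ∧ (x.ceil - y.ceil = 1 ∨ y.ceil - x.ceil = 1) then
    if x.primed = false ∧ y.primed = false ∧ z.primed = false then
      -- XYX ↔ YXY
      (⟨y.ceil, false⟩, ⟨x.ceil, false⟩, ⟨y.ceil, false⟩)
    else if x.primed = true ∧ y.primed = false ∧ z.primed = false then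
      -- X'YX ↦ YXY'
      (⟨y.ceil, false⟩, ⟨x.ceil, false⟩, ⟨y.ceil, true⟩)
    else if x.primed = false ∧ y.primed = false ∧ z.primed = true then
      -- YXY' ↦ X'YX
      (⟨y.ceil, true⟩, ⟨x.ceil, false⟩, ⟨y.ceil, false⟩)
    else (x, y, z)
  else if (x.ceil < z.ceil ∧ z.ceil < y.ceil) ∨ (y.ceil < z.ceil ∧ z.ceil < x.ceil) then
    -- ACB ↔ CAB
    (y, x, z)
  else if (y.ceil < x.ceil ∧ x.ceil < z.ceil) ∨ (z.ceil < x.ceil ∧ x.ceil < y.ceil) then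
    -- BCA ↔ BAC
    (x, z, y)
  else (x, y, z)

/-- The operator `ock_i` for `i ∈ ℤ`. -/
def ockW (i : ℤ) (a : PWord) : PWord :=
  if i = -1 then
    match a with
    | [] => []
    | x :: rest => ock1 x :: rest
  else if i = 0 then
    match a with
    | x :: y :: rest => (ock2 x y).1 :: (ock2 x y).2 :: rest
    | _ => a
  else if 1 ≤ i ∧ i + 2 ≤ (a.length : ℤ) then
    let k := (i - 1).toNat
    match a[k]?, a[k + 1]?, a[k + 2]? with
    | some x, some y, some z =>
        a.take k ++ [(ock3 x y z).1, (ock3 x y z).2.1, (ock3 x y z).2.2] ++ a.drop (k + 3)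
    | _, _, _ => a
  else a

/-- Orthogonal Coxeter–Knuth equivalence: generated by `a ∼ ock_i(a)` for all `i ∈ ℤ`. -/
def OckEquiv : PWord → PWord → Prop :=
  Relation.EqvGen (fun a b => ∃ i : ℤ, b = ockW i a)
/-! ## Descents -/

/-- Descent set of a primed word (as a set of 1-based positions). -/
def DesWord (a : PWord) : Set ℤ :=
  {i | ∃ k : ℕ, i = (k : ℤ) + 1 ∧ ∃ x y, a[k]? = some x ∧ a[k + 1]? = some y ∧ y < x}

/-- Descent set of a standard shifted tableau. -/
def DesT (T : STab) : Set ℤ :=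
  {i | 0 < i ∧ (
    (∃ r c r' c', entry? T r c = some ⟨i, false⟩ ∧
        entry? T r' c' = some ⟨i + 1, false⟩ ∧ r < r') ∨
    (∃ r c r' c', entry? T r c = some ⟨i, true⟩ ∧
        entry? T r' c' = some ⟨i + 1, true⟩ ∧ c < c') ∨
    (∃ r c r' c', entry? T r c = some ⟨i, false⟩ ∧
        entry? T r' c' = some ⟨i + 1, true⟩))}

/-! ## Dual equivalence operators on standard shifted tableaux -/

def numPrimes (T : STab) : ℕ := T.flatten.countP (fun x => x.primed)

/-- The entries of column `c`, read from bottom to top (increasing). -/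
def colLetters (T : STab) (c : ℕ) : PWord :=
  (List.range (c + 1)).filterMap (fun r => entry? T r c)

/-- The shifted reading word `unprime(C_q R_q ⋯ C_1 R_1)`. -/
def shword (T : STab) : List ℤ :=
  (((List.range (numCols T)).reverse).flatMap (fun idx =>
    (colLetters T idx).filter (fun x => x.primed) ++
      ((T.getD idx []).filter (fun x => !x.primed)))).map Letter.ceil

def idxOfZ (v : ℤ) : List ℤ → ℕ
  | [] => 0
  | x :: r => if x = v then 0 else idxOfZ v r + 1

def positionsOf (T : STab) : List (ℕ × ℕ) :=
  (List.range T.length).flatMap (fun r =>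
    (List.range (T.getD r []).length).map (fun k => (r, r + k)))

/-- The box `□_v` of `T` containing `v` or `v'`. -/
def boxOf (T : STab) (v : ℤ) : Option (ℕ × ℕ) :=
  (positionsOf T).find? (fun p =>
    match entry? T p.1 p.2 with
    | some x => decide (x.ceil = v)
    | none => false)

/-- Reverse the prime of the entry in position `(r, c)`. -/
def togglePos (T : STab) (r c : ℕ) : STab :=
  match entry? T r c with
  | some x => setEntryG T r c ⟨x.ceil, !x.primed⟩
  | none => T

/-- Switch the primes of the entries in the two given positions. -/
def switchAt (T : STab) (p q : ℕ × ℕ) : STab :=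
  match entry? T p.1 p.2, entry? T q.1 q.2 with
  | some x, some y =>
      if x.primed = y.primed then T else togglePos (togglePos T p.1 p.2) q.1 q.2
  | _, _ => T

/-- The row index of `□_v` if it is a main-diagonal box. -/
def diagBox? (T : STab) (v : ℤ) : Option ℕ :=
  (boxOf T v).bind (fun p => if p.1 = p.2 then some p.1 else none)

def switchDiag (T T' : STab) (u v : ℤ) : STab :=
  match diagBox? T u, diagBox? T v with
  | some r, some s => switchAt T' (r, r) (s, s)
  | _, _ => T'

/-- The operator `𝔰_i`. -/
def sOp (i : ℤ) (T : STab) : STab :=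
  match boxOf T i, boxOf T (i + 1) with
  | some (r1, c1), some (r2, c2) =>
      if r1 ≠ r2 ∧ c1 ≠ c2 then
        -- swap i ↔ i+1 and i' ↔ (i+1)'
        setEntryG (setEntryG T r1 c1 ⟨i + 1, ((entry? T r1 c1).getD default).primed⟩)
          r2 c2 ⟨i, ((entry? T r2 c2).getD default).primed⟩
      else if r1 ≠ c1 ∧ r2 ≠ c2 then
        -- same row or column, neither box diagonal: reverse both primes
        togglePos (togglePos T r1 c1) r2 c2
      else
        -- same row or column, one box diagonal
        let T1 := if r1 = c1 then togglePos T r2 c2 else togglePos T r1 c1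
        let T2 :=
          if 1 ≤ i - 1 ∧ (diagBox? T (i - 1)).isSome ∧ (diagBox? T (i + 1)).isSome then
            switchDiag T T1 (i - 1) (i + 1)
          else T1
        if i + 2 ≤ (T.flatten.length : ℤ) ∧ (diagBox? T i).isSome ∧
            (diagBox? T (i + 2)).isSome then
          switchDiag T T2 i (i + 2)
        else T2
  | _, _ => T

def btwn (a m b : ℕ) : Prop := (a < m ∧ m < b) ∨ (b < m ∧ m < a)

instance (a m b : ℕ) : Decidable (btwn a m b) := by unfold btwn; infer_instance

/-- The dual equivalence operator `𝔡_i` for `i ∈ ℤ`. -/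
def dOp (i : ℤ) (T : STab) : STab :=
  if ¬(1 ≤ i + 2 ∧ i + 2 ≤ (T.flatten.length : ℤ)) then T
  else if i = -1 then togglePos T 0 0
  else if i = 0 then togglePos T 0 1
  else
    let w := shword T
    if btwn (idxOfZ i w) (idxOfZ (i + 2) w) (idxOfZ (i + 1) w) then sOp i T
    else if btwn (idxOfZ (i + 1) w) (idxOfZ i w) (idxOfZ (i + 2) w) then sOp (i + 1) T
    else T

/-! ## Marked cycles -/

/-- The 2-cycles of `z`, as ordered pairs `(i, j)` with `i < j = z(i)`. -/
def cycSet (z : Equiv.Perm ℤ) : Set (ℤ × ℤ) := {p | p.1 < p.2 ∧ z p.1 = p.2}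

/-- `s_{a_n} ⋯ s_{a_{k+2}} s_{a_{k+1}}` (ordinary product; 0-based index `k`). -/
def suffixPerm (a : List ℤ) (k : ℕ) : Equiv.Perm ℤ :=
  ((a.drop (k + 1)).reverse.map sPerm).prod

/-- `γ_{k+1}(a)` as an ordered pair (junk value `(0,0)` off the commutation set). -/
def gammaPair (a : List ℤ) (k : ℕ) : ℤ × ℤ :=
  match a[k]? with
  | some x => (min (suffixPerm a k x) (suffixPerm a k (x + 1)),
               max (suffixPerm a k x) (suffixPerm a k (x + 1)))
  | none => (0, 0)
/-! ## Increasing factorization sequences and Schur Q-functions -/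

/-- `Incr_∞(R_inv^+(z))`: sequences of weakly increasing primed words, all but
finitely many empty, whose concatenation is a primed involution word for `z`. -/
def IncrSeq (z : Equiv.Perm ℤ) : Set (ℕ → PWord) :=
  {φ | (∀ n, List.Chain' (· ≤ ·) (φ n)) ∧
    ∃ N, (∀ n, N ≤ n → φ n = []) ∧ ((List.range N).map φ).flatten ∈ RinvPlus z}

/-- Least bound past which a sequence of words is empty. -/
noncomputable def seqBound (φ : ℕ → PWord) : ℕ := sInf {N | ∀ n, N ≤ n → φ n = []}

/-- The concatenation `a^1 a^2 ⋯` of a sequence of words. -/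
noncomputable def concatSeq (φ : ℕ → PWord) : PWord :=
  ((List.range (seqBound φ)).map φ).flatten

/-- `ℓ(a^1) + ⋯ + ℓ(a^i)`. -/
def prefLen (φ : ℕ → PWord) (i : ℕ) : ℕ := (((List.range i).map φ).map List.length).sum

/-- The minimal `i ≥ 1` with `j ≤ ℓ(a^1) + ⋯ + ℓ(a^i)`. -/
noncomputable def relabel (φ : ℕ → PWord) (j : ℤ) : ℤ :=
  ((sInf {i : ℕ | 1 ≤ i ∧ j ≤ (prefLen φ i : ℤ)} : ℕ) : ℤ)

/-- The semistandard recording tableau `Q_EGᴼ(φ)`. -/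
noncomputable def QEGseq (φ : ℕ → PWord) : STab :=
  (QEG (concatSeq φ)).map (List.map (fun x => (⟨relabel φ x.ceil, x.primed⟩ : Letter)))

/-- The insertion tableau `P_EGᴼ(φ)`. -/
noncomputable def PEGseq (φ : ℕ → PWord) : STab := PEG (concatSeq φ)

/-- The Schur Q-function of a strict partition: the coefficient of the monomial with
exponent vector `d` is the number of semistandard shifted tableaux `T` of the given
shape with `x^T = x^d`. -/
noncomputable def SchurQ (sh : List ℕ) : MvPowerSeries ℤ ℤ :=
  fun d => (({T : STab | shapeOf T = sh ∧ IsSemistandard T ∧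
    ∀ i : ℤ, d i = T.flatten.countP (fun x => decide (x.ceil = i))} : Set STab).ncard : ℤ)

/-- `Q_z = Σ_{φ ∈ Incr_∞(R_inv^+(z))} x^φ`. -/
noncomputable def Qz (z : Equiv.Perm ℤ) : MvPowerSeries ℤ ℤ :=
  fun d => (({φ : ℕ → PWord | φ ∈ IncrSeq z ∧
    (∀ i : ℕ, d ((i : ℤ) + 1) = (φ i).length) ∧
    (∀ j : ℤ, j ≤ 0 → d j = 0)} : Set (ℕ → PWord)).ncard : ℤ)

/-! ## Dominant involutions -/

/-- The shifted diagram `SD_λ ⊆ ℤ × ℤ` of a strict partition. -/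
def SDset (sh : List ℕ) : Set (ℤ × ℤ) :=
  {p | ∃ i j : ℕ, 1 ≤ i ∧ i ≤ sh.length ∧ 1 ≤ j ∧ j ≤ sh.getD (i - 1) 0 ∧
    p.1 = (i : ℤ) ∧ p.2 = (i : ℤ) + (j : ℤ) - 1}

/-- The involution Rothe diagram `D̂(z) = {(i,j) : z(i) > j ≤ i < z(j)}`. -/
def invRothe (z : Equiv.Perm ℤ) : Set (ℤ × ℤ) :=
  {p | p.2 < z p.1 ∧ p.2 ≤ p.1 ∧ p.1 < z p.2}

/-- The tableau `T_λ` with entry `i + j - 1` in box `(i, j)` of `SD_λ`. -/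
def Tlam (sh : List ℕ) : STab :=
  (List.range sh.length).map (fun r =>
    (List.range (sh.getD r 0)).map (fun k =>
      (⟨2 * (r : ℤ) + (k : ℤ) + 1, false⟩ : Letter)))

/-- The permutation `i + m ↦ w(i) + m` (fixing everything outside `m + support`). -/
def shiftPerm (m : ℕ) (w : Equiv.Perm ℤ) : Equiv.Perm ℤ :=
  (Equiv.addLeft (m : ℤ)).permCongr w

/-- `z ∈ S_m`: `z` fixes every point outside `[1, m]`. -/
def SupportedOn (z : Equiv.Perm ℤ) (m : ℕ) : Prop :=
  ∀ x : ℤ, x < 1 ∨ (m : ℤ) < x → z x = x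
/-! ## Primed compatible sequences -/

/-- A primed compatible sequence, recorded as the list of its columns `(index; value)`. -/
def IsPrimedCompatible (φ : List (ℕ × Letter)) : Prop :=
  (∀ p ∈ φ, 0 < p.1 ∧ 0 < p.2.ceil) ∧
  List.Chain' (fun p q : ℕ × Letter => p.1 ≤ q.1 ∧ (p.1 = q.1 → p.2 ≤ q.2)) φ ∧
  (∀ (k l : ℕ) (p : ℕ × Letter), k < l → φ[k]? = some p → φ[l]? = some p →
    p.2.primed = false)

def IsIndexStrict (φ : List (ℕ × Letter)) : Prop :=
  List.Chain' (fun p q : ℕ × Letter => p.1 < q.1) φ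

/-! ## Sagan–Worley insertion (orthogonal and symplectic versions) -/

/-- Whether `u` bumps `v`: strict comparison when inserting an unprimed letter into a
row or a primed letter into a column, weak comparison otherwise. -/
def swBump (isRow : Bool) (u v : Letter) : Bool :=
  if (isRow && !u.primed) || (!isRow && u.primed) then decide (u < v) else decide (u ≤ v)

/-- Column stage of orthogonal Sagan–Worley insertion. -/
def swColO : ℕ → STab → ℕ → Letter → STab × Bool
  | 0, T, _, _ => (T, true)
  | fuel + 1, T, c, u =>
    let occ := (List.range (c + 1)).filterMap (fun r => (entry? T r c).map (fun x => (r, x)))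
    match occ.find? (fun p => swBump false u p.2) with
    | none =>
        let r := occ.length
        let u' := if r = c ∧ u.primed then Letter.unprime u else u
        (setRowG T r ((T.getD r []) ++ [u']), true)
    | some p =>
        if p.1 = c then
          if u.ceil = p.2.ceil then swColO fuel T (c + 1) (Letter.unprime p.2)
          else
            let q := switchPrimes u p.2
            swColO fuel (setEntryG T p.1 c q.1) (c + 1) q.2
        else swColO fuel (setEntryG T p.1 c u) (c + 1) p.2

/-- Row stage of orthogonal Sagan–Worley insertion. -/
def swRowO : ℕ → STab → ℕ → Letter → STab × Bool
  | 0, T, _, _ => (T, true)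
  | fuel + 1, T, r, u =>
    let row := T.getD r []
    match row.findIdx? (fun v => swBump true u v) with
    | none =>
        if row.isEmpty ∧ u.primed then (setRowG T r [Letter.unprime u], true)
        else (setRowG T r (row ++ [u]), false)
    | some k =>
        let v := row.getD k default
        if k = 0 then
          if u.ceil = v.ceil then swColO fuel T (r + 1) (Letter.unprime v)
          else
            let q := switchPrimes u v
            swColO fuel (setRowG T r (row.set 0 q.1)) (r + 1) q.2
        else swRowO fuel (setRowG T r (row.set k u)) (r + 1) v

def swInsertO (T : STab) (u : Letter) : STab × Bool :=
  swRowO (T.flatten.length + T.length + 2) T 0 u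

/-- Column stage of symplectic (original) Sagan–Worley insertion. -/
def swColSp : ℕ → STab → ℕ → Letter → STab × Bool
  | 0, T, _, _ => (T, true)
  | fuel + 1, T, c, u =>
    let occ := (List.range (c + 1)).filterMap (fun r => (entry? T r c).map (fun x => (r, x)))
    match occ.find? (fun p => swBump false u p.2) with
    | none => (setRowG T occ.length ((T.getD occ.length []) ++ [u]), true)
    | some p =>
        if p.1 = c then
          if u.ceil = p.2.ceil then swColSp fuel T (c + 1) (Letter.unprime p.2)
          else swColSp fuel (setEntryG T p.1 c u) (c + 1) p.2
        else swColSp fuel (setEntryG T p.1 c u) (c + 1) p.2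

/-- Row stage of symplectic (original) Sagan–Worley insertion. -/
def swRowSp : ℕ → STab → ℕ → Letter → STab × Bool
  | 0, T, _, _ => (T, true)
  | fuel + 1, T, r, u =>
    let row := T.getD r []
    match row.findIdx? (fun v => swBump true u v) with
    | none => (setRowG T r (row ++ [u]), false)
    | some k =>
        let v := row.getD k default
        if k = 0 then
          if u.ceil = v.ceil then swColSp fuel T (r + 1) (Letter.unprime v)
          else swColSp fuel (setRowG T r (row.set 0 u)) (r + 1) v
        else swRowSp fuel (setRowG T r (row.set k u)) (r + 1) v

def swInsertSp (T : STab) (u : Letter) : STab × Bool :=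
  swRowSp (T.flatten.length + T.length + 2) T 0 u

def PSWO (φ : List (ℕ × Letter)) : STab := φ.foldl (fun T p => (swInsertO T p.2).1) []

def PSWSp (φ : List (ℕ × Letter)) : STab := φ.foldl (fun T p => (swInsertSp T p.2).1) []

def QSWaux (ins : STab → Letter → STab × Bool) : STab → STab → List (ℕ × Letter) → STab
  | _, Q, [] => Q
  | P, Q, p :: rest =>
      let res := ins P p.2
      QSWaux ins res.1 (addBox Q P res.1 ⟨(p.1 : ℤ), res.2⟩) rest

def QSWO (φ : List (ℕ × Letter)) : STab := QSWaux swInsertO [] [] φ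

def QSWSp (φ : List (ℕ × Letter)) : STab := QSWaux swInsertSp [] [] φ

/-- Entry `A_{ij}` of the circled matrix of `φ` (forgetting the circles). -/
def cmEntry (φ : List (ℕ × Letter)) (i j : ℕ) : ℕ :=
  φ.countP (fun p => decide (p.1 = i ∧ p.2.ceil = (j : ℤ)))

/-! ## Shifted mixed insertion (orthogonal and symplectic versions) -/

/-- Tableaux whose entries are signed letters `(ε, u)`, `ε ∈ {+, -}`
(`true` records the sign `-`). -/
abbrev MTab := List (List (Bool × Letter))

def extractO (U : MTab) : STab :=
  U.map (fun row =>
    match row with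
    | [] => []
    | (e, x) :: rest => (if e then (⟨x.ceil, true⟩ : Letter) else x) :: rest.map Prod.snd)

def extractSp (U : MTab) : STab := U.map (List.map Prod.snd)

/-- One mixed insertion, of the pair `β` into row (`isCol = false`) or column
(`isCol = true`) number `idx`; returns the tableau and the added box. -/
def hmIns (sympl : Bool) : ℕ → MTab → Bool → ℕ → Bool × Letter → MTab × (ℕ × ℕ)
  | 0, T, _, _, _ => (T, (0, 0))
  | fuel + 1, T, isCol, idx, β =>
    if isCol then
      let c := idx
      let occ := (List.range (c + 1)).filterMap
        (fun r => (entryG? T r c).map (fun x => (r, x)))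
      match occ.find? (fun p => decide (β.2 < p.2.2)) with
      | none =>
          let r := occ.length
          (setRowG T r ((T.getD r []) ++ [β]), (r, c))
      | some p =>
          if p.1 = c then
            hmIns sympl fuel
              (setEntryG T p.1 c (if sympl then (p.2.1, β.2) else β)) true (c + 1)
              (if sympl then (β.1, ⟨p.2.2.ceil, true⟩) else (p.2.1, ⟨p.2.2.ceil, true⟩))
          else
            hmIns sympl fuel (setEntryG T p.1 c (p.2.1, β.2)) p.2.2.primed
              (if p.2.2.primed then c + 1 else p.1 + 1) (β.1, p.2.2)
    else
      let r := idx
      let row := T.getD r []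
      match row.findIdx? (fun p => decide (β.2 < p.2)) with
      | none => (setRowG T r (row ++ [β]), (r, r + row.length))
      | some k =>
          let q := row.getD k default
          if k = 0 then
            hmIns sympl fuel
              (setRowG T r (row.set 0 (if sympl then (q.1, β.2) else β))) true (r + 1)
              (if sympl then (β.1, ⟨q.2.ceil, true⟩) else (q.1, ⟨q.2.ceil, true⟩))
          else
            hmIns sympl fuel (setRowG T r (row.set k (q.1, β.2))) q.2.primed
              (if q.2.primed then r + k + 1 else r + 1) (β.1, q.2)

def hmInsert (sympl : Bool) (T : MTab) (x : Letter) : MTab × (ℕ × ℕ) :=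
  hmIns sympl (2 * T.flatten.length + 4) T false 0 (x.primed, ⟨x.ceil, false⟩)

def hmAuxCS (sympl : Bool) : MTab → STab → List (ℕ × Letter) → MTab × STab
  | U, Q, [] => (U, Q)
  | U, Q, p :: rest =>
      let res := hmInsert sympl U p.2
      let pos := res.2
      let sgn := ((entryG? res.1 pos.1 pos.2).map Prod.fst).getD false
      let pr : Bool := if sympl then sgn else (decide (pos.1 ≠ pos.2) && sgn)
      hmAuxCS sympl res.1
        (setRowG Q pos.1 ((Q.getD pos.1 []) ++ [(⟨(p.1 : ℤ), pr⟩ : Letter)])) rest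

def PHMO (φ : List (ℕ × Letter)) : STab := extractO (hmAuxCS false [] [] φ).1
def QHMO (φ : List (ℕ × Letter)) : STab := (hmAuxCS false [] [] φ).2
def PHMSp (φ : List (ℕ × Letter)) : STab := extractSp (hmAuxCS true [] [] φ).1
def QHMSp (φ : List (ℕ × Letter)) : STab := (hmAuxCS true [] [] φ).2

/-- A primed word, identified with the primed compatible sequence with
index row `1, 2, …, n`. -/
def wordCS (a : PWord) : List (ℕ × Letter) :=
  ((List.range a.length).zip a).map (fun p => (p.1 + 1, p.2))

/-! ## The transpose of a primed compatible sequence -/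

def insSortedCS (p : ℕ × Letter) : List (ℕ × Letter) → List (ℕ × Letter)
  | [] => [p]
  | q :: rest =>
      if p.1 < q.1 ∨ (p.1 = q.1 ∧ p.2 ≤ q.2) then p :: q :: rest
      else q :: insSortedCS p rest

def sortCS (l : List (ℕ × Letter)) : List (ℕ × Letter) := l.foldr insSortedCS []

/-- `φ^⊤`: move each prime from the value to the index above it, interchange the two
rows, and reorder the columns lexicographically. -/
def transposeCS (φ : List (ℕ × Letter)) : List (ℕ × Letter) :=
  sortCS (φ.map (fun p => (p.2.ceil.toNat, (⟨(p.1 : ℤ), p.2.primed⟩ : Letter))))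

/-! ## Involution words up to braid relations -/

/-- The right Demazure action `σ ↦ σ ∘ s_i`. -/
def demazure (σ : Equiv.Perm ℤ) (i : ℤ) : Equiv.Perm ℤ :=
  if σ i < σ (i + 1) then σ * sPerm i else σ

lemma mul_sPerm_apply (σ : Equiv.Perm ℤ) (i x : ℤ) :
    (σ * sPerm i) x = σ (if x = i then i + 1 else if x = i + 1 then i else x) := by
  simp [sPerm, Equiv.Perm.mul_apply, Equiv.swap_apply_def]

lemma demazure_idem (σ : Equiv.Perm ℤ) (i : ℤ) :
    demazure (demazure σ i) i = demazure σ i := by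
  unfold demazure
  split_ifs with h1 h2 <;> try rfl
  simp only [mul_sPerm_apply] at h2
  simp at h2
  omega

/-- Letters whose simple transpositions commute and differ. -/
def Far (x y : ℤ) : Prop := x + 2 ≤ y ∨ y + 2 ≤ x

lemma Far.symm {x y : ℤ} (h : Far x y) : Far y x := Or.symm h

lemma sPerm_comm {i j : ℤ} (h : Far i j) : sPerm i * sPerm j = sPerm j * sPerm i := by
  unfold Far at h
  ext x
  simp only [sPerm, Equiv.Perm.mul_apply, Equiv.swap_apply_def]
  split_ifs <;> omega

lemma sPerm_braid (i : ℤ) :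
    sPerm i * sPerm (i + 1) * sPerm i = sPerm (i + 1) * sPerm i * sPerm (i + 1) := by
  ext x
  simp only [sPerm, Equiv.Perm.mul_apply, Equiv.swap_apply_def]
  split_ifs <;> omega

lemma demazure_comm (σ : Equiv.Perm ℤ) {i j : ℤ} (h : Far i j) :
    demazure (demazure σ i) j = demazure (demazure σ j) i := by
  have key : ∀ {i j : ℤ}, Far i j → (σ * sPerm i) j = σ j ∧ (σ * sPerm i) (j + 1) = σ (j + 1) := by
    intro i j h
    unfold Far at h
    constructor <;> rw [mul_sPerm_apply] <;> congr 1 <;> split_ifs <;> omega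
  obtain ⟨h1, h2⟩ := key h
  obtain ⟨h3, h4⟩ := key h.symm
  unfold demazure
  by_cases hi : σ i < σ (i + 1) <;> by_cases hj : σ j < σ (j + 1)
  · rw [if_pos hi, if_pos hj, if_pos (by rwa [h1, h2]), if_pos (by rwa [h3, h4]), mul_assoc,
      mul_assoc, sPerm_comm h]
  · rw [if_pos hi, if_neg hj, if_neg (by rwa [h1, h2]), if_pos hi]
  · rw [if_neg hi, if_pos hj, if_neg (by rwa [h3, h4])]
  · rw [if_neg hi, if_neg hj, if_neg hi]

lemma demazure_braid (σ : Equiv.Perm ℤ) (i : ℤ) :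
    demazure (demazure (demazure σ i) (i + 1)) i =
      demazure (demazure (demazure σ (i + 1)) i) (i + 1) := by
  have h01 : σ i ≠ σ (i + 1) := fun h => by simpa using σ.injective h
  have h12 : σ (i + 1) ≠ σ (i + 1 + 1) := fun h => by simpa using σ.injective h
  have h02 : σ i ≠ σ (i + 1 + 1) := fun h => by have := σ.injective h; omega
  have e1 : i + 1 + 1 ≠ i := by omega
  have e2 : i ≠ i + 1 + 1 := by omega
  have br := sPerm_braid i
  rcases lt_or_gt_of_ne h01 with a | a <;> rcases lt_or_gt_of_ne h12 with b | b <;>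
    rcases lt_or_gt_of_ne h02 with c | c <;> first
    | (exfalso; omega)
    | (simp [-Equiv.Perm.coe_mul, demazure, mul_sPerm_apply, a, b, c, a.not_gt, b.not_gt,
        c.not_gt, e1, e2]; done)
    | (simp [-Equiv.Perm.coe_mul, demazure, mul_sPerm_apply, a, b, c, e1, e2]
       simpa [-Equiv.Perm.coe_mul, mul_assoc] using br)

/-- Words of equal length with the same Demazure action, read in either direction. -/
structure BraidEq (l m : List ℤ) : Prop where
  length_eq : l.length = m.length
  act_eq : ∀ σ, l.foldl demazure σ = m.foldl demazure σ
  act_reverse_eq : ∀ σ, l.reverse.foldl demazure σ = m.reverse.foldl demazure σ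

namespace BraidEq

lemma refl (l : List ℤ) : BraidEq l l := ⟨rfl, fun _ => rfl, fun _ => rfl⟩

lemma symm {l m : List ℤ} (h : BraidEq l m) : BraidEq m l :=
  ⟨h.1.symm, fun σ => (h.2 σ).symm, fun σ => (h.3 σ).symm⟩

lemma trans {l m n : List ℤ} (h : BraidEq l m) (h' : BraidEq m n) : BraidEq l n :=
  ⟨h.1.trans h'.1, fun σ => (h.2 σ).trans (h'.2 σ), fun σ => (h.3 σ).trans (h'.3 σ)⟩

lemma append {l m l' m' : List ℤ} (h : BraidEq l m) (h' : BraidEq l' m') :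
    BraidEq (l ++ l') (m ++ m') := by
  refine ⟨by simp [h.1, h'.1], fun σ => ?_, fun σ => ?_⟩
  · simp [h.2, h'.2]
  · simp only [List.reverse_append, List.foldl_append, h.3, h'.3]

lemma append_left {l m : List ℤ} (p : List ℤ) (h : BraidEq l m) : BraidEq (p ++ l) (p ++ m) :=
  (refl p).append h

lemma append_right {l m : List ℤ} (h : BraidEq l m) (p : List ℤ) : BraidEq (l ++ p) (m ++ p) :=
  h.append (refl p)

lemma cons {l m : List ℤ} (x : ℤ) (h : BraidEq l m) : BraidEq (x :: l) (x :: m) :=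
  h.append_left [x]

lemma reverse {l m : List ℤ} (h : BraidEq l m) : BraidEq l.reverse m.reverse :=
  ⟨by simp [h.1], h.3, by simpa using h.2⟩

lemma swap {x y : ℤ} (h : Far x y) : BraidEq [x, y] [y, x] :=
  ⟨rfl, fun σ => by simp [demazure_comm σ h], fun σ => by simp [demazure_comm σ h]⟩

lemma braid (x : ℤ) : BraidEq [x, x + 1, x] [x + 1, x, x + 1] :=
  ⟨rfl, fun σ => by simp [demazure_braid σ], fun σ => by simp [demazure_braid σ]⟩

lemma cons_comm {w : ℤ} {l : List ℤ} (h : ∀ x ∈ l, Far w x) : BraidEq (w :: l) (l ++ [w]) := by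
  induction l with
  | nil => exact refl _
  | cons y l ih =>
    exact ((swap (h y (by simp))).append_right l).trans
      ((ih fun x hx => h x (by simp [hx])).cons y)

lemma append_comm {l m : List ℤ} (h : ∀ x ∈ l, ∀ y ∈ m, Far x y) :
    BraidEq (l ++ m) (m ++ l) := by
  induction l with
  | nil => simpa using refl m
  | cons x l ih =>
    have h1 := (ih fun x hx => h x (by simp [hx])).cons x
    have h2 := (cons_comm (h x (by simp))).append_right l
    simpa using h1.trans h2

/-- Bumping the entry `M` of a row by a smaller letter `w`. -/
lemma bump {A B : List ℤ} {w M : ℤ} (hA : ∀ a ∈ A, a < w) (hw : w < M) (hB : ∀ b ∈ B, M < b) :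
    BraidEq (A ++ M :: B ++ [w]) (M :: (A ++ w :: B)) := by
  have h1 : BraidEq (B ++ [w]) (w :: B) :=
    (cons_comm fun x hx => Or.inl (by have := hB x hx; omega)).symm
  have h2 : BraidEq (A ++ [M]) (M :: A) :=
    (cons_comm fun x hx => Or.inr (by have := hA x hx; omega)).symm
  simpa using (h1.append_left (A ++ [M])).trans (h2.append_right (w :: B))

/-- Inserting `w` into a row that contains `w` and `w + 1`. -/
lemma bump_self {A B : List ℤ} {w : ℤ} (hA : ∀ a ∈ A, a < w) (hB : ∀ b ∈ B, w + 1 < b) :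
    BraidEq (A ++ w :: (w + 1) :: B ++ [w]) ((w + 1) :: (A ++ w :: (w + 1) :: B)) := by
  have h1 : BraidEq (B ++ [w]) (w :: B) :=
    (cons_comm fun x hx => Or.inl (by have := hB x hx; omega)).symm
  have h2 : BraidEq (A ++ [w + 1]) ((w + 1) :: A) :=
    (cons_comm fun x hx => Or.inr (by have := hA x hx; omega)).symm
  have h3 := ((braid w).append_left A).append_right B
  simpa using ((h1.append_left (A ++ [w, w + 1])).trans (by simpa using h3)).trans
    (h2.append_right (w :: (w + 1) :: B))

end BraidEq

lemma invHecke_eq (a : List ℤ) : invHecke a = (a.reverse ++ a).foldl demazure 1 := by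
  cases a with
  | nil => rfl
  | cons x a =>
    change ((x :: a).reverse ++ a).foldl demazure 1 = _
    simp [demazure_idem]

/-- A word of minimal length among those with the same value of `invHecke`. -/
def InvReduced (a : List ℤ) : Prop := ∀ b, invHecke b = invHecke a → a.length ≤ b.length

namespace InvReduced

lemma congr {a b : List ℤ} (h : BraidEq a b) (ha : InvReduced a) : InvReduced b := by
  intro c hc
  rw [← h.length_eq]
  refine ha c (hc.trans ?_)
  simp only [invHecke_eq, List.foldl_append, h.act_reverse_eq, h.act_eq]

lemma swap_head {x y : ℤ} {a : List ℤ} (ha : InvReduced (x :: y :: a)) :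
    InvReduced (y :: x :: a) := by
  intro c hc
  refine ha c (hc.trans ?_)
  simp only [invHecke_eq, List.reverse_cons, List.foldl_append, List.foldl_cons, List.foldl_nil,
    demazure_idem]
  congr 1
  generalize List.foldl demazure 1 a.reverse = σ
  rcases lt_trichotomy x y with h | rfl | h
  · obtain rfl | h : y = x + 1 ∨ x + 2 ≤ y := by omega
    · exact demazure_braid σ x
    · rw [demazure_comm σ (Or.inl h), demazure_idem, demazure_comm _ (Or.inl h), demazure_idem]
  · rfl
  · obtain rfl | h : x = y + 1 ∨ y + 2 ≤ x := by omega
    · exact (demazure_braid σ y).symm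
    · rw [demazure_comm σ (Or.inr h), demazure_idem, demazure_comm _ (Or.inr h), demazure_idem]

lemma not_append_cons_cons (p s : List ℤ) (x : ℤ) : ¬ InvReduced (p ++ x :: x :: s) := by
  intro h
  have := h (p ++ x :: s) (by simp [invHecke_eq, demazure_idem])
  simp at this

end InvReduced

/-! ## Symmetric increasing arrays

A shifted tableau is extended by reflection across its main diagonal, with `⊤` in empty boxes.
Row and column insertion then both become insertion into a row of a symmetric array. -/

/-- An infinite array of integers, with `⊤` marking empty boxes. -/
abbrev Arr := ℕ → ℕ → WithTop ℤ

/-- Symmetric arrays with rows and columns strictly increasing up to the empty boxes. -/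
structure SymInc (t : Arr) : Prop where
  symm : ∀ a b, t a b = t b a
  row : ∀ a b, t a (b + 1) = ⊤ ∨ t a b < t a (b + 1)

namespace SymInc

variable {t : Arr} (ht : SymInc t)
include ht

lemma row_lt {a b c : ℕ} (h : b < c) : t a c = ⊤ ∨ t a b < t a c := by
  induction c, h using Nat.le_induction with
  | base => exact ht.row a b
  | succ c _ ih =>
    rcases ht.row a c with h | h
    · exact Or.inl h
    · rcases ih with h' | h'
      · simp [h'] at h
      · exact Or.inr (h'.trans h)

lemma row_le {a b c : ℕ} (h : b ≤ c) : t a b ≤ t a c := by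
  rcases h.eq_or_lt with rfl | h
  · rfl
  · rcases ht.row_lt (a := a) h with h | h
    · simp [h]
    · exact h.le

lemma col_lt {a b c : ℕ} (h : a < b) : t b c = ⊤ ∨ t a c < t b c := by
  rw [ht.symm b c, ht.symm a c]
  exact ht.row_lt h

lemma col_le {a b c : ℕ} (h : a ≤ b) : t a c ≤ t b c := by
  rw [ht.symm b c, ht.symm a c]
  exact ht.row_le h

lemma row_lt_of_eq {a b c : ℕ} {x : ℤ} (h : b < c) (hx : t a c = x) : t a b < t a c :=
  (ht.row_lt h).resolve_left (by simp [hx])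

lemma col_lt_of_eq {a b c : ℕ} {x : ℤ} (h : a < b) (hx : t b c = x) : t a c < t b c :=
  (ht.col_lt h).resolve_left (by simp [hx])

lemma lt_of_lt {a b c : ℕ} (h : t a b < t a c) : b < c := by
  by_contra! hc
  exact absurd h (not_lt.2 (ht.row_le hc))

/-- Entries lying strictly in opposite corners differ by at least two. -/
lemma add_two_le {a b a' b' : ℕ} {x y : ℤ} (ha : a < a') (hb : b < b') (hx : t a b = x)
    (hy : t a' b' = y) : x + 2 ≤ y := by
  have h1 := ht.col_lt_of_eq ha hy
  obtain ⟨z, hz⟩ := WithTop.ne_top_iff_exists.1 (h1.trans_le le_top).ne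
  have h2 := ht.row_lt_of_eq hb hz.symm
  rw [hx, ← hz, WithTop.coe_lt_coe] at h2
  rw [hy, ← hz, WithTop.coe_lt_coe] at h1
  omega

end SymInc

/-- The word with a single letter, or no letter for an empty box. -/
def letters : WithTop ℤ → List ℤ := WithTop.recTopCoe [] fun a => [a]

@[simp] lemma letters_top : letters ⊤ = [] := rfl

@[simp] lemma letters_coe (a : ℤ) : letters a = [a] := rfl

@[simp] lemma mem_letters {x : ℤ} {y : WithTop ℤ} : x ∈ letters y ↔ y = x := by
  induction y using WithTop.recTopCoe <;> simp [eq_comm]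

/-- The entries in rows `r₀ ≤ r < r₁` and columns `c₀ ≤ c < c₁` on or above the main diagonal, with
each row read left to right, starting from the last row. -/
def reading (t : Arr) (r₀ r₁ c₀ c₁ : ℕ) : List ℤ :=
  (List.Ico r₀ r₁).reverse.flatMap fun r => (List.Ico c₀ c₁).flatMap fun c =>
    if r ≤ c then letters (t r c) else []

lemma mem_reading {t : Arr} {r₀ r₁ c₀ c₁ : ℕ} {x : ℤ} :
    x ∈ reading t r₀ r₁ c₀ c₁ ↔
      ∃ r c, r₀ ≤ r ∧ r < r₁ ∧ c₀ ≤ c ∧ c < c₁ ∧ r ≤ c ∧ t r c = x := by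
  simp only [reading, List.mem_flatMap, List.mem_reverse, List.Ico.mem, List.mem_ite_nil_right,
    mem_letters]
  constructor
  · rintro ⟨r, ⟨h1, h2⟩, c, ⟨h3, h4⟩, h5, h6⟩
    exact ⟨r, c, h1, h2, h3, h4, h5, h6⟩
  · rintro ⟨r, c, h1, h2, h3, h4, h5, h6⟩
    exact ⟨r, ⟨h1, h2⟩, c, ⟨h3, h4⟩, h5, h6⟩

lemma reading_rows {t : Arr} {r₀ r₁ r₂ c₀ c₁ : ℕ} (h : r₀ ≤ r₁) (h' : r₁ ≤ r₂) :
    reading t r₀ r₂ c₀ c₁ = reading t r₁ r₂ c₀ c₁ ++ reading t r₀ r₁ c₀ c₁ := by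
  simp [reading, ← List.Ico.append_consecutive h h']

lemma reading_row_cols {t : Arr} {r c₀ c₁ c₂ : ℕ} (h : c₀ ≤ c₁) (h' : c₁ ≤ c₂) :
    reading t r (r + 1) c₀ c₂ = reading t r (r + 1) c₀ c₁ ++ reading t r (r + 1) c₁ c₂ := by
  simp [reading, ← List.Ico.append_consecutive h h']

lemma reading_box (t : Arr) (r c : ℕ) :
    reading t r (r + 1) c (c + 1) = if r ≤ c then letters (t r c) else [] := by
  simp [reading]

lemma reading_congr {t t' : Arr} {r₀ r₁ c₀ c₁ : ℕ}
    (h : ∀ r c, r₀ ≤ r → r < r₁ → c₀ ≤ c → c < c₁ → r ≤ c → t r c = t' r c) :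
    reading t r₀ r₁ c₀ c₁ = reading t' r₀ r₁ c₀ c₁ := by
  unfold reading
  refine List.flatMap_congr fun r hr => List.flatMap_congr fun c hc => ?_
  simp only [List.mem_reverse, List.Ico.mem] at hr hc
  split_ifs with hrc
  · rw [h r c hr.1 hr.2 hc.1 hc.2 hrc]
  · rfl

lemma reading_eq_nil {t : Arr} {r₀ r₁ c₀ c₁ : ℕ}
    (h : ∀ r c, r₀ ≤ r → r < r₁ → c₀ ≤ c → c < c₁ → r ≤ c → t r c = ⊤) :
    reading t r₀ r₁ c₀ c₁ = [] := by
  rw [List.eq_nil_iff_forall_not_mem]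
  intro x hx
  obtain ⟨r, c, h1, h2, h3, h4, h5, h6⟩ := mem_reading.1 hx
  simp [h r c h1 h2 h3 h4 h5] at h6

/-- Reading a range of columns in two blocks only changes a word by commutations. -/
lemma SymInc.reading_cols {t : Arr} (ht : SymInc t) {r₀ r₁ c₀ c₁ c₂ : ℕ} (hr : r₀ ≤ r₁)
    (h : c₀ ≤ c₁) (h' : c₁ ≤ c₂) :
    BraidEq (reading t r₀ r₁ c₀ c₂) (reading t r₀ r₁ c₀ c₁ ++ reading t r₀ r₁ c₁ c₂) := by
  induction r₁, hr using Nat.le_induction with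
  | base => simpa [reading] using BraidEq.refl []
  | succ r hr ih =>
    have hs : ∀ c c', reading t r₀ (r + 1) c c' = reading t r (r + 1) c c' ++ reading t r₀ r c c' :=
      fun c c' => reading_rows hr (Nat.le_succ r)
    rw [hs, hs, hs, reading_row_cols h h']
    have hc : BraidEq (reading t r (r + 1) c₁ c₂ ++ reading t r₀ r c₀ c₁)
        (reading t r₀ r c₀ c₁ ++ reading t r (r + 1) c₁ c₂) := by
      refine BraidEq.append_comm fun x hx y hy => ?_
      obtain ⟨a, b, _, _, _, _, _, hx⟩ := mem_reading.1 hx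
      obtain ⟨a', b', _, _, _, _, _, hy⟩ := mem_reading.1 hy
      exact Or.inr (ht.add_two_le (by omega) (by omega) hy hx)
    have h1 := ih.append_left (reading t r (r + 1) c₀ c₁ ++ reading t r (r + 1) c₁ c₂)
    have h2 := (hc.append_left (reading t r (r + 1) c₀ c₁)).append_right (reading t r₀ r c₁ c₂)
    simpa using h1.trans (by simpa using h2)

/-- The symmetric array with the entries in positions `(s, k)` and `(k, s)` changed to `x`. -/
def symUpdate (t : Arr) (s k : ℕ) (x : WithTop ℤ) : Arr := fun a b =>
  if (a = s ∧ b = k) ∨ (a = k ∧ b = s) then x else t a b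

lemma symUpdate_self (t : Arr) (s k : ℕ) (x : WithTop ℤ) : symUpdate t s k x s k = x := by
  simp [symUpdate]

lemma symUpdate_of_ne {t : Arr} {s k a b : ℕ} {x : WithTop ℤ}
    (h : ¬ ((a = s ∧ b = k) ∨ (a = k ∧ b = s))) : symUpdate t s k x a b = t a b := if_neg h

lemma symUpdate_eq_self {t : Arr} (ht : SymInc t) {s k : ℕ} {x : WithTop ℤ} (h : t s k = x) :
    symUpdate t s k x = t := by
  funext a b
  unfold symUpdate
  split_ifs with hab
  · rcases hab with ⟨rfl, rfl⟩ | ⟨rfl, rfl⟩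
    · exact h.symm
    · rw [ht.symm, h]
  · rfl

lemma SymInc.symUpdate {t : Arr} (ht : SymInc t) {s k : ℕ} {w : ℤ} (hk : ∀ b < k, t s b < w)
    (hw : w ≤ t s k) (hs : ∀ s', s = s' + 1 → t s' k < w) : SymInc (symUpdate t s k w) := by
  refine ⟨fun a b => ?_, fun a b => ?_⟩
  · unfold _root_.symUpdate
    rw [ht.symm a b]
    grind
  · have h1 := ht.row a b
    have key : ∀ x y : WithTop ℤ, y = ⊤ ∨ x < y → w ≤ x → y = ⊤ ∨ w < y := by
      rintro x y (h | h) hx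
      · exact Or.inl h
      · exact Or.inr (hx.trans_lt h)
    unfold _root_.symUpdate
    by_cases hb1 : (a = s ∧ b + 1 = k) ∨ (a = k ∧ b + 1 = s)
    · have hb : ¬ ((a = s ∧ b = k) ∨ (a = k ∧ b = s)) := by omega
      rw [if_pos hb1, if_neg hb]
      right
      rcases hb1 with ⟨rfl, rfl⟩ | ⟨rfl, rfl⟩
      · exact hk b (by omega)
      · rw [ht.symm]; exact hs b rfl
    · rw [if_neg hb1]
      split_ifs with hb
      · rcases hb with ⟨rfl, rfl⟩ | ⟨rfl, rfl⟩
        · exact key _ _ h1 hw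
        · exact key _ _ h1 (by rwa [ht.symm])
      · exact h1

/-! ## One step of insertion into a symmetric array -/

/-- Inserting `w` into the line `A, m, C` of a tableau bumps `m`, or `w + 1` if `m = w` is followed
by `w + 1`, unless the resulting word is not reduced. -/
lemma line_insert {A C C' : List ℤ} {m m' : WithTop ℤ} {w : ℤ} (hA : ∀ a ∈ A, a < w)
    (hm : w ≤ m) (hm' : m' = ⊤ ∨ m < m') (hC : C = letters m' ++ C')
    (hC' : ∀ c ∈ C', m' < (c : WithTop ℤ)) :
    m = ⊤ ∨
    (∃ w' : ℤ, ((m = w' ∧ w < w') ∨ (m = w ∧ w' = w + 1 ∧ m' = w')) ∧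
      BraidEq (A ++ letters m ++ C ++ [w]) (w' :: (A ++ w :: C))) ∨
    ∃ p q x, BraidEq (A ++ letters m ++ C ++ [w]) (p ++ x :: x :: q) := by
  have hC'nil : m' = ⊤ → C' = [] := fun h => by
    rw [List.eq_nil_iff_forall_not_mem]
    intro c hc
    have := hC' c hc
    simp [h] at this
  induction m using WithTop.recTopCoe with
  | top => exact Or.inl rfl
  | coe M =>
    right
    rw [WithTop.coe_le_coe] at hm
    have hgt : ∀ c ∈ C, M < c := by
      intro c hc
      rw [← WithTop.coe_lt_coe]
      rw [hC, List.mem_append, mem_letters] at hc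
      rcases hc with hc | hc
      · rcases hm' with h | h
        · simp [h] at hc
        · rwa [← hc]
      · rcases hm' with h | h
        · simp [hC'nil h] at hc
        · exact h.trans (hC' c hc)
    rcases hm.lt_or_eq with hlt | rfl
    · refine Or.inl ⟨M, Or.inl ⟨rfl, hlt⟩, ?_⟩
      simpa using BraidEq.bump hA hlt hgt
    · by_cases hnext : m' = ((w + 1 : ℤ) : WithTop ℤ)
      · refine Or.inl ⟨w + 1, Or.inr ⟨rfl, rfl, hnext⟩, ?_⟩
        have h2 := BraidEq.bump_self (B := C') hA fun b hb => by
          have := hC' b hb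
          rwa [hnext, WithTop.coe_lt_coe] at this
        have hC2 : C = (w + 1) :: C' := by rw [hC, hnext]; rfl
        simpa [hC2] using h2
      · refine Or.inr ⟨A, C, w, ?_⟩
        have h2 : ∀ c ∈ C, Far w c := by
          intro c hc
          left
          have h1 := hgt c hc
          rcases eq_or_ne c (w + 1) with rfl | hne
          · exfalso
            rw [hC, List.mem_append, mem_letters] at hc
            rcases hc with hc | hc
            · exact hnext hc
            · have h3 := hC' _ hc
              rcases hm' with h | h
              · simp [h] at h3
              · obtain ⟨z, hz⟩ := WithTop.ne_top_iff_exists.1 h3.ne_top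
                rw [← hz, WithTop.coe_lt_coe] at h h3
                omega
          · omega
        simpa using (BraidEq.cons_comm h2).symm.append_left (A ++ [w])

lemma InvReduced.move_front {Z Y L : List ℤ} {x w : ℤ} (hZ : ∀ z ∈ Z, x + 2 ≤ z)
    (hY : ∀ y ∈ Y, x < y) (hw : w < x) (h : InvReduced (Z ++ x :: Y ++ w :: L)) :
    InvReduced (w :: (Z ++ x :: Y) ++ L) := by
  have h1 : BraidEq (Y ++ [w]) (w :: Y) :=
    (BraidEq.cons_comm fun y hy => Or.inl (by have := hY y hy; omega)).symm
  have h2 : BraidEq (Z ++ [x, w]) ([x, w] ++ Z) := by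
    refine BraidEq.append_comm fun z hz y hy => ?_
    have := hZ z hz
    simp only [List.mem_cons, List.not_mem_nil, or_false] at hy
    right
    omega
  have h3 : BraidEq (Z ++ [x]) (x :: Z) :=
    (BraidEq.cons_comm fun z hz => Or.inl (hZ z hz)).symm
  have h5 : BraidEq (Z ++ x :: (Y ++ [w])) (x :: w :: (Z ++ Y)) := by
    refine BraidEq.trans ?_ (by simpa using h2.append_right Y)
    simpa using h1.append_left (Z ++ [x])
  have h4 : InvReduced (x :: w :: (Z ++ Y ++ L)) :=
    h.congr (by simpa using h5.append_right L)
  exact h4.swap_head.congr (by simpa using (h3.symm.append_right (Y ++ L)).cons w)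

lemma InvReduced.move_from_front {Z Y L : List ℤ} {x w : ℤ} (hZ : ∀ z ∈ Z, z + 2 ≤ x)
    (hY : ∀ y ∈ Y, y < x) (hw : x < w) (h : InvReduced (w :: (Z ++ x :: Y) ++ L)) :
    InvReduced (Z ++ x :: Y ++ w :: L) := by
  have h1 : BraidEq (w :: Y) (Y ++ [w]) :=
    BraidEq.cons_comm fun y hy => Or.inr (by have := hY y hy; omega)
  have h2 : BraidEq ([x, w] ++ Z) (Z ++ [x, w]) := by
    refine (BraidEq.append_comm fun z hz y hy => ?_).symm
    have := hZ z hz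
    simp only [List.mem_cons, List.not_mem_nil, or_false] at hy
    left
    omega
  have h3 : BraidEq (Z ++ [x]) (x :: Z) :=
    (BraidEq.cons_comm fun z hz => Or.inr (hZ z hz)).symm
  have h4 : InvReduced (w :: x :: (Z ++ Y ++ L)) :=
    h.congr (by simpa using (h3.append_right (Y ++ L)).cons w)
  have h5 : BraidEq (x :: w :: (Z ++ Y)) (Z ++ x :: (Y ++ [w])) := by
    refine BraidEq.trans (by simpa using h2.append_right Y) ?_
    simpa using h1.append_left (Z ++ [x])
  exact h4.swap_head.congr (by simpa using h5.append_right L)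

/-- A letter bumped from the main diagonal may be inserted into the next column. -/
lemma SymInc.diagonal_transition {t : Arr} (ht : SymInc t) {B s : ℕ} {w w' : ℤ} {L : List ℤ}
    (hs : s + 1 < B) (hw : t s s = w) (hww : w < w') (hw' : w' < t (s + 1) (s + 1))
    (h : InvReduced (reading t (s + 1) B 0 B ++ w' :: (reading t 0 (s + 1) 0 B ++ L))) :
    InvReduced (reading t 0 B 0 (s + 1) ++ w' :: (reading t 0 B (s + 1) B ++ L)) := by
  have h1 : InvReduced (w' :: (reading t (s + 1) B 0 B ++ (reading t 0 (s + 1) 0 B ++ L))) := by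
    generalize reading t 0 (s + 1) 0 B ++ L = M at h ⊢
    rcases eq_or_ne (t (s + 1) (s + 1)) ⊤ with htop | hne
    · rw [reading_eq_nil] at h ⊢
      · exact h
      all_goals
        intro r c h1 h2 h3 h4 h5
        rw [eq_top_iff, ← htop]
        exact (ht.row_le (by omega)).trans (ht.col_le h1)
    · obtain ⟨x, hx⟩ := WithTop.ne_top_iff_exists.1 hne
      have hsplit : reading t (s + 1) B 0 B =
          reading t (s + 2) B 0 B ++ x :: reading t (s + 1) (s + 2) (s + 2) B := by
        rw [reading_rows (show s + 1 ≤ s + 2 by omega) (by omega),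
          reading_row_cols (c₁ := s + 1) (by omega) (by omega),
          reading_row_cols (c₀ := s + 1) (c₁ := s + 2) (by omega) (by omega), reading_box,
          reading_eq_nil (c₁ := s + 1)]
        · simp [← hx]
        · intros; omega
      rw [hsplit] at h ⊢
      rw [← hx, WithTop.coe_lt_coe] at hw'
      rw [← List.cons_append]
      refine InvReduced.move_front (fun z hz => ?_) (fun y hy => ?_) hw' h
      · obtain ⟨r, c, h1, h2, h3, h4, h5, h6⟩ := mem_reading.1 hz
        exact ht.add_two_le (by omega) (by omega) hx.symm h6
      · obtain ⟨r, c, h1, h2, h3, h4, h5, h6⟩ := mem_reading.1 hy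
        obtain rfl : r = s + 1 := by omega
        have := ht.row_lt_of_eq (show s + 1 < c by omega) h6
        rwa [← hx, h6, WithTop.coe_lt_coe] at this
  have h2 : reading t (s + 1) B 0 B ++ (reading t 0 (s + 1) 0 B ++ L) = reading t 0 B 0 B ++ L := by
    rw [← List.append_assoc, ← reading_rows (by omega) (by omega)]
  have h3 : reading t 0 B s (s + 1) = w :: reading t 0 s s (s + 1) := by
    rw [reading_rows (r₁ := s + 1) (by omega) (by omega),
      reading_rows (r₁ := s) (r₂ := s + 1) (by omega) (by omega), reading_box,
      reading_eq_nil (r₀ := s + 1)]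
    · simp [hw]
    · intros; omega
  have h4 : BraidEq (reading t 0 B 0 B)
      (reading t 0 B 0 s ++ w :: reading t 0 s s (s + 1) ++ reading t 0 B (s + 1) B) := by
    rw [← h3]
    exact (ht.reading_cols (by omega) (by omega) (by omega)).trans
      ((ht.reading_cols (by omega) (by omega) (by omega)).append_right _)
  rw [h2] at h1
  have h5 := InvReduced.move_from_front (L := reading t 0 B (s + 1) B ++ L) (fun z hz => ?_)
    (fun y hy => ?_) hww (h1.congr (by simpa using (h4.append_right L).cons w'))
  · refine h5.congr (BraidEq.append_right ?_ _)
    rw [← h3]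
    exact (ht.reading_cols (by omega) (by omega) (by omega)).symm
  · obtain ⟨r, c, h1, h2, h3, h4, h5, h6⟩ := mem_reading.1 hz
    exact ht.add_two_le (by omega) (by omega) h6 hw
  · obtain ⟨r, c, h1, h2, h3, h4, h5, h6⟩ := mem_reading.1 hy
    obtain rfl : c = s := by omega
    have := ht.col_lt_of_eq (show r < c by omega) hw
    rwa [hw, h6, WithTop.coe_lt_coe] at this

/-- The reading word of an array together with a letter `w` about to be inserted into row `s`
(if `s ≤ j`) or column `s` (if `j < s`). -/
def stateWord (t : Arr) (B s j : ℕ) (w : ℤ) : List ℤ :=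
  if s ≤ j then reading t s B 0 B ++ w :: reading t 0 s 0 B
  else reading t 0 B 0 s ++ w :: reading t 0 B s B

/-- The conditions met when `w` is about to be inserted into line `s` of the array `t`, having been
bumped from column `j` of the preceding line. The remaining letters form the word `rest`. -/
structure InsertState (t : Arr) (n B s j : ℕ) (w : ℤ) (rest : List ℤ) : Prop where
  symInc : SymInc t
  supp : ∀ a b, n ≤ b → t a b = ⊤
  lt_bound : n + 1 < B
  line_le : s ≤ n
  col_le : j ≤ n
  le : w ≤ t s j
  lt : ∀ s', s = s' + 1 → t s' j < w
  reduced : InvReduced (stateWord t B s j w ++ rest)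

namespace InsertState

variable {t : Arr} {n B s j : ℕ} {w : ℤ} {rest : List ℤ}

lemma le_of_le (h : InsertState t n B s j w rest) {k : ℕ} (hk : ∀ b < k, t s b < w)
    (hwk : w ≤ t s k) (hsj : s ≤ j) : s ≤ k := by
  cases s with
  | zero => omega
  | succ s =>
    by_contra! hks
    have h1 := h.lt s rfl
    have h2 := h.symInc.row_le (a := s) hsj
    rw [h.symInc.symm] at h2
    exact absurd ((h.symInc.row_le (by omega)).trans_lt (h2.trans_lt h1)) (not_lt.2 hwk)

lemma symInc_update (h : InsertState t n B s j w rest) {k : ℕ} (hkj : k ≤ j)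
    (hk : ∀ b < k, t s b < w) (hwk : w ≤ t s k) : SymInc (symUpdate t s k w) :=
  h.symInc.symUpdate hk hwk fun s' hs => (h.symInc.row_le hkj).trans_lt (h.lt s' hs)

/-- The words arising from insertion into a row. -/
lemma row_word (h : InsertState t n B s j w rest) (hsj : s ≤ j) {k : ℕ} (hkj : k ≤ j)
    (hk : ∀ b < k, t s b < w) (hwk : w ≤ t s k) :
    (t s k = ⊤ ∧ InvReduced (reading (symUpdate t s k w) 0 B 0 B ++ rest)) ∨
    ∃ w' : ℤ, ((t s k = w' ∧ w < w') ∨ (t s k = w ∧ w' = w + 1 ∧ t s (k + 1) = w')) ∧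
      InvReduced (reading (symUpdate t s k w) (s + 1) B 0 B ++
        w' :: (reading (symUpdate t s k w) 0 (s + 1) 0 B ++ rest)) := by
  have hsk := h.le_of_le hk hwk hsj
  have ht := h.symInc
  have hB := h.lt_bound
  have hn := h.col_le
  have hred := h.reduced
  have hl := h.line_le
  set t' := symUpdate t s k w with ht'
  set A := reading t s (s + 1) 0 k
  set C := reading t s (s + 1) (k + 1) B with hC
  have hrow : reading t s (s + 1) 0 B = A ++ letters (t s k) ++ C := by
    rw [reading_row_cols (c₁ := k) (by omega) (by omega),
      reading_row_cols (c₀ := k) (c₁ := k + 1) (by omega) (by omega), reading_box, if_pos hsk,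
      List.append_assoc]
  have hrow' : reading t' s (s + 1) 0 B = A ++ w :: C := by
    rw [reading_row_cols (c₁ := k) (by omega) (by omega),
      reading_row_cols (c₀ := k) (c₁ := k + 1) (by omega) (by omega), reading_box, if_pos hsk,
      ht', symUpdate_self, letters_coe]
    congr 1
    · exact reading_congr fun r c _ _ _ _ _ => symUpdate_of_ne (by omega)
    · exact congrArg _ (reading_congr fun r c _ _ _ _ _ => symUpdate_of_ne (by omega))
  have hup : reading t' (s + 1) B 0 B = reading t (s + 1) B 0 B :=
    reading_congr fun r c _ _ _ _ _ => symUpdate_of_ne (by omega)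
  have hdown : reading t' 0 s 0 B = reading t 0 s 0 B :=
    reading_congr fun r c _ _ _ _ _ => symUpdate_of_ne (by omega)
  have hpre : reading t' 0 (s + 1) 0 B = A ++ w :: C ++ reading t 0 s 0 B := by
    rw [reading_rows (r₁ := s) (by omega) (by omega), hrow', hdown]
  rw [stateWord, if_pos hsj, reading_rows (r₁ := s + 1) (by omega) (by omega), hrow] at hred
  have hA : ∀ a ∈ A, a < w := by
    intro a ha
    obtain ⟨r, c, h1, h2, h3, h4, h5, h6⟩ := mem_reading.1 ha
    obtain rfl : r = s := by omega
    rw [← WithTop.coe_lt_coe, ← h6]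
    exact hk c h4
  have hCsplit : C = letters (t s (k + 1)) ++ reading t s (s + 1) (k + 2) B := by
    rw [hC, reading_row_cols (c₁ := k + 2) (by omega) (by omega), reading_box, if_pos (by omega)]
  have hC' : ∀ c ∈ reading t s (s + 1) (k + 2) B, t s (k + 1) < c := by
    intro c hc
    obtain ⟨r, c', h1, h2, h3, h4, h5, h6⟩ := mem_reading.1 hc
    obtain rfl : r = s := by omega
    rw [← h6]
    exact ht.row_lt_of_eq (by omega) h6
  rcases line_insert hA hwk (ht.row s k) hCsplit hC' with htop | ⟨w', hw', hbr⟩ | hbad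
  · refine Or.inl ⟨htop, ?_⟩
    have hCnil : C = [] := reading_eq_nil fun r c _ _ _ _ _ => by
      obtain rfl : r = s := by omega
      rw [eq_top_iff, ← htop]
      exact ht.row_le (by omega)
    rw [reading_rows (r₁ := s + 1) (by omega) (by omega), hup, hpre]
    simpa [htop, hCnil] using hred
  · refine Or.inr ⟨w', hw', ?_⟩
    rw [hup, hpre]
    refine hred.congr ?_
    simpa using (hbr.append_left (reading t (s + 1) B 0 B)).append_right
      (reading t 0 s 0 B ++ rest)
  · obtain ⟨p, q, x, hbr⟩ := hbad
    refine absurd (hred.congr (b := (reading t (s + 1) B 0 B ++ p) ++ x :: x ::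
      (q ++ reading t 0 s 0 B ++ rest)) ?_) (InvReduced.not_append_cons_cons _ _ _)
    simpa using (hbr.append_left (reading t (s + 1) B 0 B)).append_right
      (reading t 0 s 0 B ++ rest)

/-- The words arising from insertion into a column. -/
lemma col_word (h : InsertState t n B s j w rest) (hjs : j < s) {k : ℕ} (hkj : k ≤ j)
    (hk : ∀ b < k, t s b < w) (hwk : w ≤ t s k) :
    (t s k = ⊤ ∧ InvReduced (reading (symUpdate t s k w) 0 B 0 B ++ rest)) ∨
    ∃ w' : ℤ, ((t s k = w' ∧ w < w') ∨ (t s k = w ∧ w' = w + 1 ∧ t s (k + 1) = w')) ∧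
      InvReduced (reading (symUpdate t s k w) 0 B 0 (s + 1) ++
        w' :: (reading (symUpdate t s k w) 0 B (s + 1) B ++ rest)) := by
  have ht := h.symInc
  have hB := h.lt_bound
  have hn := h.line_le
  have hred := h.reduced
  have hti := h.symInc_update hkj hk hwk
  set t' := symUpdate t s k w with ht'
  set A := reading t 0 k s (s + 1)
  set C := reading t (k + 1) B s (s + 1) with hC
  have hcol : reading t 0 B s (s + 1) = C ++ letters (t s k) ++ A := by
    rw [reading_rows (r₁ := k + 1) (by omega) (by omega),
      reading_rows (r₁ := k) (r₂ := k + 1) (by omega) (by omega), reading_box,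
      if_pos (by omega), ht.symm k s, List.append_assoc]
  have hcol' : reading t' 0 B s (s + 1) = C ++ w :: A := by
    rw [reading_rows (r₁ := k + 1) (by omega) (by omega),
      reading_rows (r₁ := k) (r₂ := k + 1) (by omega) (by omega), reading_box,
      if_pos (by omega), hti.symm k s, ht', symUpdate_self, letters_coe]
    congr 1
    · exact reading_congr fun r c _ _ _ _ _ => symUpdate_of_ne (by omega)
    · exact congrArg _ (reading_congr fun r c _ _ _ _ _ => symUpdate_of_ne (by omega))
  have hleft : reading t' 0 B 0 s = reading t 0 B 0 s :=
    reading_congr fun r c _ _ _ _ _ => symUpdate_of_ne (by omega)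
  have hright : reading t' 0 B (s + 1) B = reading t 0 B (s + 1) B :=
    reading_congr fun r c _ _ _ _ _ => symUpdate_of_ne (by omega)
  have hpre : BraidEq (reading t' 0 B 0 (s + 1)) (reading t 0 B 0 s ++ (C ++ w :: A)) := by
    rw [← hcol', ← hleft]
    exact hti.reading_cols (by omega) (by omega) (by omega)
  have hsplit : BraidEq (reading t 0 B s B)
      (C ++ letters (t s k) ++ A ++ reading t 0 B (s + 1) B) := by
    rw [← hcol]
    exact ht.reading_cols (by omega) (by omega) (by omega)
  rw [stateWord, if_neg (by omega)] at hred
  replace hred : InvReduced (reading t 0 B 0 s ++ w :: (C ++ letters (t s k) ++ A ++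
      reading t 0 B (s + 1) B) ++ rest) :=
    hred.congr (((hsplit.cons w).append_left _).append_right rest)
  have hA : ∀ a ∈ A.reverse, a < w := by
    intro a ha
    obtain ⟨r, c, h1, h2, h3, h4, h5, h6⟩ := mem_reading.1 (List.mem_reverse.1 ha)
    obtain rfl : c = s := by omega
    rw [← WithTop.coe_lt_coe, ← h6, ht.symm]
    exact hk r h2
  have hCsplit : C.reverse =
      letters (t s (k + 1)) ++ (reading t (k + 2) B s (s + 1)).reverse := by
    rw [hC, reading_rows (r₁ := k + 2) (by omega) (by omega), reading_box, if_pos (by omega),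
      ht.symm (k + 1)]
    induction t s (k + 1) using WithTop.recTopCoe <;> simp
  have hlet : (letters (t s k)).reverse = letters (t s k) := by
    induction t s k using WithTop.recTopCoe <;> simp
  have hC' : ∀ c ∈ (reading t (k + 2) B s (s + 1)).reverse, t s (k + 1) < c := by
    intro c hc
    obtain ⟨r, c', h1, h2, h3, h4, h5, h6⟩ := mem_reading.1 (List.mem_reverse.1 hc)
    obtain rfl : c' = s := by omega
    rw [← h6, ht.symm c']
    exact ht.col_lt_of_eq (by omega) h6
  rcases line_insert hA hwk (ht.row s k) hCsplit hC' with htop | ⟨w', hw', hbr⟩ | hbad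
  · refine Or.inl ⟨htop, ?_⟩
    have hCnil : C = [] := reading_eq_nil fun r c _ _ _ _ _ => by
      obtain rfl : c = s := by omega
      rw [eq_top_iff, ← htop, ht.symm r]
      exact ht.row_le (by omega)
    refine hred.congr (BraidEq.append_right ?_ rest)
    rw [htop, hCnil, ← hright]
    refine BraidEq.trans ?_ (hti.reading_cols (r₀ := 0) (r₁ := B) (c₁ := s + 1) (by omega)
      (by omega) (by omega)).symm
    have := (hpre.append_right (reading t' 0 B (s + 1) B)).symm
    simpa [hCnil] using this
  · refine Or.inr ⟨w', hw', ?_⟩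
    rw [hright]
    have h1 := hbr.reverse
    simp only [List.reverse_append, List.reverse_cons, List.reverse_reverse, List.reverse_nil,
      List.nil_append, hlet] at h1
    have h2 : BraidEq (reading t 0 B 0 s ++ w :: (C ++ letters (t s k) ++ A ++
        reading t 0 B (s + 1) B) ++ rest) (reading t 0 B 0 s ++ (C ++ w :: A) ++ [w'] ++
        (reading t 0 B (s + 1) B ++ rest)) := by
      simpa using (h1.append_left (reading t 0 B 0 s)).append_right
        (reading t 0 B (s + 1) B ++ rest)
    refine hred.congr (h2.trans ?_)
    simpa using hpre.symm.append_right (w' :: (reading t 0 B (s + 1) B ++ rest))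
  · obtain ⟨p, q, x, hbr⟩ := hbad
    have h1 := hbr.reverse
    simp only [List.reverse_append, List.reverse_cons, List.reverse_reverse, List.reverse_nil,
      List.nil_append, hlet] at h1
    refine absurd (hred.congr (b := (reading t 0 B 0 s ++ q.reverse) ++ x :: x ::
      (p.reverse ++ reading t 0 B (s + 1) B ++ rest)) ?_) (InvReduced.not_append_cons_cons _ _ _)
    simpa using (h1.append_left (reading t 0 B 0 s)).append_right
      (reading t 0 B (s + 1) B ++ rest)

/-- One step of insertion: `w` is placed in column `k` of line `s`, and the insertion either ends
there or continues with a letter `w'` to be inserted into line `s + 1`. -/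
lemma step (h : InsertState t n B s j w rest) :
    ∃ k ≤ j, (s ≤ j → s ≤ k) ∧ (∀ b < k, t s b < w) ∧ w ≤ t s k ∧ SymInc (symUpdate t s k w) ∧
      ((t s k = ⊤ ∧ InvReduced (reading (symUpdate t s k w) 0 B 0 B ++ rest)) ∨
      ∃ w' : ℤ, ((t s k = w' ∧ w < w') ∨ (t s k = w ∧ w' = w + 1 ∧ t s (k + 1) = w')) ∧
        InsertState (symUpdate t s k w) n B (s + 1) k w' rest) := by
  classical
  have hex : ∃ k, w ≤ t s k := ⟨j, h.le⟩
  obtain ⟨k, hkj, hk, hwk⟩ : ∃ k ≤ j, (∀ b < k, t s b < w) ∧ w ≤ t s k :=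
    ⟨Nat.find hex, Nat.find_min' hex h.le, fun b hb => not_le.1 (Nat.find_min hex hb),
      Nat.find_spec hex⟩
  have hti := h.symInc_update hkj hk hwk
  have hsk := h.le_of_le hk hwk
  refine ⟨k, hkj, hsk, hk, hwk, hti, ?_⟩
  have next : ∀ w' : ℤ, ((t s k = w' ∧ w < w') ∨ (t s k = w ∧ w' = w + 1 ∧ t s (k + 1) = w')) →
      InvReduced (stateWord (symUpdate t s k w) B (s + 1) k w' ++ rest) →
      InsertState (symUpdate t s k w) n B (s + 1) k w' rest := by
    intro w' hw' hred
    have hfin : t s k ≠ ⊤ := by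
      rcases hw' with ⟨h1, _⟩ | ⟨h1, _⟩ <;> simp [h1]
    have hkn : k < n := by
      by_contra! hc
      exact hfin (h.supp s k hc)
    have hsn : s < n := by
      by_contra! hc
      exact hfin (by rw [h.symInc.symm, h.supp k s hc])
    refine ⟨hti, fun a b hb => ?_, h.lt_bound, hsn, hkn.le, ?_, ?_, hred⟩
    · rw [symUpdate_of_ne (by omega)]
      exact h.supp a b hb
    · rw [symUpdate_of_ne (by omega)]
      have h1 := h.symInc.col_lt (c := k) (Nat.lt_succ_self s)
      rcases hw' with ⟨h2, _⟩ | ⟨h2, rfl, _⟩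
      · rw [← h2]
        exact h.symInc.col_le (Nat.le_succ s)
      · rw [h2] at h1
        rcases h1 with h1 | h1
        · simp [h1]
        · change ((w : ℤ) : WithTop ℤ) < t (s + 1) k at h1
          generalize t (s + 1) k = y at h1 ⊢
          induction y using WithTop.recTopCoe with
          | top => simp
          | coe y => rw [WithTop.coe_lt_coe] at h1; rw [WithTop.coe_le_coe]; omega
    · intro s' hs'
      obtain rfl : s = s' := by omega
      rw [symUpdate_self, WithTop.coe_lt_coe]
      omega
  rcases le_or_gt s j with hsj | hjs
  · rcases h.row_word hsj hkj hk hwk with h1 | ⟨w', hw', hred⟩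
    · exact Or.inl h1
    · refine Or.inr ⟨w', hw', next w' hw' ?_⟩
      rcases (hsk hsj).lt_or_eq with hlt | heq
      · rw [stateWord, if_pos (by omega)]
        simpa using hred
      · rw [stateWord, if_neg (by omega)]
        subst heq
        have h2 := hti.diagonal_transition (s := s) (w := w) (w' := w') (L := rest)
          (by have := h.line_le; have := h.lt_bound; omega) (symUpdate_self ..) (by omega) ?_ hred
        · simpa using h2
        · rw [symUpdate_of_ne (by omega)]
          have ht := h.symInc
          rcases ht.col_lt (a := s) (b := s + 1) (c := s + 1) (by omega) with h3 | h3
          · simp [h3]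
          · refine lt_of_le_of_lt ?_ h3
            rcases hw' with ⟨h4, _⟩ | ⟨_, _, h4⟩
            · rw [← h4]; exact ht.row_le (by omega)
            · exact h4.ge
  · rcases h.col_word hjs hkj hk hwk with h1 | ⟨w', hw', hred⟩
    · exact Or.inl h1
    · refine Or.inr ⟨w', hw', next w' hw' ?_⟩
      rw [stateWord, if_neg (by omega)]
      simpa using hred

end InsertState

/-! ## Bumping paths -/

/-- The insertion of a letter into lines `s, …, e` of the symmetric array `t` results in `t'`:
the letter `U i` is placed in line `i` and column `K i`. -/
structure BumpPath (t t' : Arr) (s e : ℕ) (U : ℕ → WithTop ℤ) (K : ℕ → ℕ) : Prop where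
  symInc : SymInc t
  symInc' : SymInc t'
  le : s ≤ e
  top : U (e + 1) = ⊤
  lt : ∀ i, s ≤ i → i ≤ e → U i < U (i + 1)
  anti : ∀ i, s ≤ i → i < e → K (i + 1) ≤ K i
  val : ∀ i, s ≤ i → i ≤ e → t' i (K i) = U i
  diff : ∀ a b, t' a b = t a b ∨ ∃ i, s ≤ i ∧ i ≤ e ∧ ((a = i ∧ b = K i) ∨ (a = K i ∧ b = i)) ∧
    t' a b = U i ∧ t a b = U (i + 1)
  next_le : ∀ i b, s ≤ i → i ≤ e → U i < t i b → U (i + 1) ≤ t i b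
  exists_eq_next : ∀ i, s ≤ i → i ≤ e → ∃ b, t i b = U (i + 1)
  special : ∀ i, s ≤ i → i ≤ e → t i (K i) = U i → U (i + 1) = U i + 1

namespace BumpPath

variable {t t' t'' : Arr} {s e f : ℕ} {U V : ℕ → WithTop ℤ} {K L : ℕ → ℕ}

/-- An insertion which ends in the line where it starts. -/
lemma single {k : ℕ} {w : ℤ} (ht : SymInc t) (ht' : SymInc (symUpdate t s k w))
    (hk : ∀ b < k, t s b < w) (htop : t s k = ⊤) :
    BumpPath t (symUpdate t s k w) s s (fun i => if i ≤ s then w else ⊤) fun _ => k where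
  symInc := ht
  symInc' := ht'
  le := le_rfl
  top := by simp
  lt i h1 h2 := by
    obtain rfl : i = s := by omega
    simp
  anti i h1 h2 := le_rfl
  val i h1 h2 := by
    obtain rfl : i = s := by omega
    simp [symUpdate_self]
  diff a b := by
    by_cases hab : (a = s ∧ b = k) ∨ (a = k ∧ b = s)
    · refine Or.inr ⟨s, le_rfl, le_rfl, hab, by simp [symUpdate, hab], ?_⟩
      rcases hab with ⟨rfl, rfl⟩ | ⟨rfl, rfl⟩
      · simp [htop]
      · simp [ht.symm a, htop]
    · exact Or.inl (symUpdate_of_ne hab)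
  next_le i b h1 h2 h3 := by
    obtain rfl : i = s := by omega
    simp only [le_refl, if_true] at h3
    have hb : k ≤ b := by
      by_contra! hc
      exact lt_asymm h3 (hk b hc)
    rw [eq_top_iff.2 (htop.ge.trans (ht.row_le hb))]
    exact le_top
  exists_eq_next i h1 h2 := by
    obtain rfl : i = s := by omega
    exact ⟨k, by simp [htop]⟩
  special i h1 h2 h3 := by
    obtain rfl : i = s := by omega
    simp [htop] at h3

section

variable (h : BumpPath t t' s e U K)
include h

lemma strictMono {i j : ℕ} (hi : s ≤ i) (hij : i < j) (hj : j ≤ e + 1) : U i < U j := by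
  induction j, hij using Nat.le_induction with
  | base => exact h.lt i hi (by omega)
  | succ j hij ih => exact (ih (by omega)).trans (h.lt j (by omega) (by omega))

lemma lt_of_lt {i j : ℕ} (hi : i ≤ e + 1) (hj : s ≤ j) (hU : U i < U j) : i < j := by
  by_contra! hc
  rcases hc.eq_or_lt with rfl | hc
  · exact lt_irrefl _ hU
  · exact lt_asymm hU (h.strictMono hj hc hi)

lemma antitone {i j : ℕ} (hi : s ≤ i) (hij : i ≤ j) (hj : j ≤ e) : K j ≤ K i := by
  induction j, hij using Nat.le_induction with
  | base => rfl
  | succ j hij ih => exact (h.anti j (by omega) (by omega)).trans (ih (by omega))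

lemma ne_top {i : ℕ} (h1 : s ≤ i) (h2 : i ≤ e) : U i ≠ ⊤ := (h.lt i h1 h2).ne_top

lemma arr_le (a b : ℕ) : t' a b ≤ t a b := by
  rcases h.diff a b with h1 | ⟨i, h1, h2, -, h4, h5⟩
  · exact h1.le
  · rw [h4, h5]
    exact (h.lt i h1 h2).le

lemma eq_or_eq_next {i : ℕ} (hi : s ≤ i) (hie : i ≤ e) :
    t i (K i) = U i ∨ t i (K i) = U (i + 1) := by
  have hv := h.val i hi hie
  rcases h.diff i (K i) with h1 | ⟨j, h1, h2, -, h4, h5⟩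
  · exact Or.inl (h1 ▸ hv)
  · right
    rw [hv] at h4
    obtain rfl : i = j := by
      by_contra hne
      rcases Nat.lt_or_gt_of_ne hne with hc | hc
      · exact (h.strictMono hi hc (by omega)).ne h4
      · exact (h.strictMono h1 hc (by omega)).ne' h4
    exact h5

lemma last_eq_top : t e (K e) = ⊤ := by
  rcases h.eq_or_eq_next h.le le_rfl with h1 | h1
  · have h2 := h.special e h.le le_rfl h1
    rw [h.top] at h2
    have h3 := h.ne_top h.le le_rfl
    obtain ⟨x, hx⟩ := WithTop.ne_top_iff_exists.1 h3
    rw [← hx] at h2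
    exact absurd h2.symm (WithTop.coe_ne_top (a := x + 1))
  · rw [h1, h.top]

/-- The shape of the array grows by the box in line `e` and column `K e`. -/
lemma ne_top_iff (a b : ℕ) :
    t' a b ≠ ⊤ ↔ t a b ≠ ⊤ ∨ (a = e ∧ b = K e) ∨ (a = K e ∧ b = e) := by
  constructor
  · intro h1
    rcases h.diff a b with h2 | ⟨i, h2, h3, h4, h5, h6⟩
    · exact Or.inl (h2 ▸ h1)
    · rcases h3.eq_or_lt with rfl | h7
      · exact Or.inr h4
      · left
        rw [h6]
        exact h.ne_top (by omega) (by omega)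
  · rintro (h1 | ⟨rfl, rfl⟩ | ⟨rfl, rfl⟩)
    · exact ne_top_of_le_ne_top h1 (h.arr_le a b)
    · rw [h.val _ h.le le_rfl]
      exact h.ne_top h.le le_rfl
    · rw [h.symInc'.symm, h.val _ h.le le_rfl]
      exact h.ne_top h.le le_rfl

end

/-- Prepend one bump to a bumping path. -/
lemma cons {k : ℕ} {w w' : ℤ} (ht : SymInc t) (hk : ∀ b < k, t s b < w)
    (hw' : (t s k = w' ∧ w < w') ∨ (t s k = w ∧ w' = w + 1 ∧ t s (k + 1) = w'))
    (h : BumpPath (symUpdate t s k w) t' (s + 1) e U K) (hU : U (s + 1) = w')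
    (hK : K (s + 1) ≤ k) :
    BumpPath t t' s e (Function.update U s w) (Function.update K s k) := by
  have hww : w < w' := by
    rcases hw' with h1 | h1 <;> omega
  have hUw : ∀ i, s + 1 ≤ i → i ≤ e + 1 → (w' : WithTop ℤ) ≤ U i := by
    intro i h1 h2
    rw [← hU]
    rcases h1.eq_or_lt with rfl | h1
    · rfl
    · exact (h.strictMono le_rfl h1 h2).le
  have hwU : ∀ i, s + 1 ≤ i → i ≤ e + 1 → (w : WithTop ℤ) < U i := fun i h1 h2 =>
    (WithTop.coe_lt_coe.2 hww).trans_le (hUw i h1 h2)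
  have hUi : ∀ i, s + 1 ≤ i → Function.update U s (w : WithTop ℤ) i = U i := fun i hi =>
    Function.update_of_ne (by omega) ..
  have hKi : ∀ i, s + 1 ≤ i → Function.update K s k i = K i := fun i hi =>
    Function.update_of_ne (by omega) ..
  have hpos : ∀ {a b}, ((a = s ∧ b = k) ∨ (a = k ∧ b = s)) →
      symUpdate t s k w a b = w ∧ t a b = t s k := by
    rintro a b (⟨rfl, rfl⟩ | ⟨rfl, rfl⟩)
    · exact ⟨symUpdate_self .., rfl⟩
    · exact ⟨by simp [symUpdate], ht.symm _ _⟩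
  have hsk : t s k ≤ w' := by
    rcases hw' with ⟨h1, -⟩ | ⟨h1, -⟩
    · exact h1.le
    · rw [h1, WithTop.coe_le_coe]
      omega
  have hval : t' s k = w := by
    rcases h.diff s k with h1 | ⟨i, h1, h2, -, h4, h5⟩
    · rw [h1, symUpdate_self]
    · rw [symUpdate_self] at h5
      exact absurd h5 (hwU (i + 1) (by omega) (by omega)).ne
  have hle := h.le
  refine ⟨ht, h.symInc', by omega, ?_, ?_, ?_, ?_, ?_, ?_, ?_, ?_⟩
  · rw [hUi _ (by omega), h.top]
  · intro i h1 h2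
    rw [hUi (i + 1) (by omega)]
    rcases h1.eq_or_lt with rfl | h1
    · rw [Function.update_self, hU, WithTop.coe_lt_coe]
      exact hww
    · rw [hUi _ h1]
      exact h.lt i h1 h2
  · intro i h1 h2
    rw [hKi _ (by omega)]
    rcases h1.eq_or_lt with rfl | h1
    · rwa [Function.update_self]
    · rw [hKi _ h1]
      exact h.anti i h1 h2
  · intro i h1 h2
    rcases h1.eq_or_lt with rfl | h1
    · rw [Function.update_self, Function.update_self, hval]
    · rw [hUi _ h1, hKi _ h1]
      exact h.val i h1 h2
  · intro a b
    rcases h.diff a b with h1 | ⟨i, h1, h2, h3, h4, h5⟩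
    · by_cases hab : (a = s ∧ b = k) ∨ (a = k ∧ b = s)
      · obtain ⟨h2, h3⟩ := hpos hab
        rcases hw' with ⟨h4, -⟩ | ⟨h4, -⟩
        · refine Or.inr ⟨s, le_rfl, by omega, ?_, ?_, ?_⟩
          · rwa [Function.update_self]
          · rw [h1, h2, Function.update_self]
          · rw [h3, h4, hUi _ le_rfl, hU]
        · left
          rw [h1, h2, h3, h4]
      · left
        rw [h1, symUpdate_of_ne hab]
    · refine Or.inr ⟨i, by omega, h2, ?_, ?_, ?_⟩
      · rwa [hKi _ h1]
      · rw [h4, hUi _ h1]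
      · have hab : ¬ ((a = s ∧ b = k) ∨ (a = k ∧ b = s)) := fun hab => by
          rw [(hpos hab).1] at h5
          exact (hwU (i + 1) (by omega) (by omega)).ne h5
        rw [← symUpdate_of_ne (t := t) (x := w) hab, h5, hUi _ (by omega)]
  · intro i b h1 h2 h3
    rw [hUi _ (by omega)]
    rcases h1.eq_or_lt with rfl | h1
    · rw [Function.update_self] at h3
      rw [hU]
      have hb : k ≤ b := by
        by_contra! hc
        exact lt_asymm h3 (hk b hc)
      rcases hw' with ⟨h4, -⟩ | ⟨h4, -, h5⟩
      · rw [← h4]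
        exact ht.row_le hb
      · rcases hb.eq_or_lt with rfl | hb
        · exact absurd h3 (by simp [h4])
        · rw [← h5]
          exact ht.row_le hb
    · rw [hUi _ h1] at h3
      have hab : ¬ ((i = s ∧ b = k) ∨ (i = k ∧ b = s)) := fun hab => by
        rw [(hpos hab).2] at h3
        exact absurd (h3.trans_le hsk) (not_lt.2 (hUw i h1 (by omega)))
      rw [← symUpdate_of_ne (t := t) (x := w) hab] at h3 ⊢
      exact h.next_le i b h1 h2 h3
  · intro i h1 h2
    rw [hUi (i + 1) (by omega)]
    rcases h1.eq_or_lt with rfl | h1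
    · rw [hU]
      rcases hw' with ⟨h4, -⟩ | ⟨-, -, h5⟩
      · exact ⟨k, h4⟩
      · exact ⟨k + 1, h5⟩
    · obtain ⟨b, hb⟩ := h.exists_eq_next i h1 h2
      refine ⟨b, ?_⟩
      have hab : ¬ ((i = s ∧ b = k) ∨ (i = k ∧ b = s)) := fun hab => by
        rw [(hpos hab).1] at hb
        exact (hwU (i + 1) (by omega) (by omega)).ne hb
      rw [← symUpdate_of_ne (t := t) (x := w) hab, hb]
  · intro i h1 h2 h3
    rw [hUi _ (by omega)]
    rcases h1.eq_or_lt with rfl | h1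
    · rw [Function.update_self, Function.update_self] at h3
      rw [hU, Function.update_self]
      rcases hw' with ⟨h4, h5⟩ | ⟨-, h4, -⟩
      · rw [h3, WithTop.coe_inj] at h4
        omega
      · rw [h4]
        rfl
    · rw [hUi _ h1] at h3 ⊢
      rw [hKi _ h1] at h3
      have hv := h.val i h1 h2
      have hab : ¬ ((i = s ∧ K i = k) ∨ (i = k ∧ K i = s)) := by
        rintro (⟨h4, -⟩ | ⟨rfl, h5⟩)
        · omega
        · rw [h5, h.symInc'.symm, hval] at hv
          exact (hwU i h1 (by omega)).ne hv
      exact h.special i h1 h2 (by rw [symUpdate_of_ne hab, h3])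

/-- Inserting a smaller letter after a larger one. -/
theorem lt_and_le_of_gt (h : BumpPath t t' 0 e U K) (h' : BumpPath t' t'' 0 f V L)
    (hlt : V 0 < U 0) : e < f ∧ L f ≤ K e := by
  have claim : ∀ s ≤ e, s ≤ f ∧ V s < U s ∧ V (s + 1) ≤ U s := by
    have aux : ∀ s ≤ e, s ≤ f → V s < U s → V (s + 1) ≤ U s := fun s h1 h2 h3 => by
      rw [← h.val s (Nat.zero_le _) h1] at h3 ⊢
      exact h'.next_le s _ (Nat.zero_le _) h2 h3
    intro s
    induction s with
    | zero => exact fun h1 => ⟨Nat.zero_le _, hlt, aux 0 h1 (Nat.zero_le _) hlt⟩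
    | succ s ih =>
      intro hs
      obtain ⟨h1, h2, h3⟩ := ih (by omega)
      have h4 := h3.trans_lt (h.lt s (Nat.zero_le _) (by omega))
      have h5 : s + 1 ≤ f := by
        by_contra! hc
        obtain rfl : s = f := by omega
        rw [h'.top] at h4
        exact not_top_lt h4
      exact ⟨h5, h4, aux (s + 1) hs h5 h4⟩
  obtain ⟨hef, hVU, hnext⟩ := claim e le_rfl
  have hef' : e < f := by
    refine hef.lt_of_ne ?_
    rintro rfl
    rw [h'.top] at hnext
    exact h.ne_top (Nat.zero_le _) le_rfl (top_le_iff.1 hnext)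
  refine ⟨hef', (h'.antitone (Nat.zero_le _) hef le_rfl).trans ?_⟩
  by_contra! hc
  have hval' := h'.val e (Nat.zero_le _) hef
  obtain ⟨x, hx⟩ := WithTop.ne_top_iff_exists.1 (h'.ne_top (Nat.zero_le _) hef)
  have h1 := h'.symInc'.row_lt_of_eq hc (hval'.trans hx.symm)
  rw [hval'] at h1
  have hval := h.val e (Nat.zero_le _) le_rfl
  rcases h'.diff e (K e) with h2 | ⟨i, -, h2, -, h3, h4⟩
  · rw [h2, hval] at h1
    exact lt_asymm h1 hVU
  · rw [h3] at h1
    have h5 := h'.lt_of_lt (by omega) (Nat.zero_le _) h1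
    rw [hval] at h4
    refine absurd hVU (not_lt.2 ?_)
    rw [h4]
    rcases (show i + 1 ≤ e from h5).eq_or_lt with rfl | h6
    · rfl
    · exact (h'.strictMono (Nat.zero_le _) h6 (by omega)).le

/-- Inserting a larger letter after a smaller one. -/
theorem le_and_lt_of_lt (h : BumpPath t t' 0 e U K) (h' : BumpPath t' t'' 0 f V L)
    (hlt : U 0 < V 0) : f ≤ e ∧ K e < L f := by
  have h0 := Nat.zero_le
  have inj : ∀ {u : Arr} {a b c : ℕ}, SymInc u → u a b ≠ ⊤ → u a b = u a c → b = c := by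
    intro u a b c hu h1 h2
    obtain ⟨x, hx⟩ := WithTop.ne_top_iff_exists.1 h1
    by_contra hne
    rcases Nat.lt_or_gt_of_ne hne with h3 | h3
    · exact (hu.row_lt_of_eq h3 (h2.symm.trans hx.symm)).ne h2
    · exact (hu.row_lt_of_eq h3 hx.symm).ne' h2
  have claim : ∀ s ≤ f, s ≤ e ∧ (U s < V s ∨
      ∃ p, s = p + 1 ∧ V s = U s ∧ K s = p ∧ U p < V p ∧ t s (K s) = U (s + 1)) := by
    intro s
    induction s with
    | zero => exact fun _ => ⟨h0 _, Or.inl hlt⟩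
    | succ s ih =>
      intro hs
      obtain ⟨hse, hP⟩ := ih (by omega)
      have hV := h'.lt s (h0 _) (by omega)
      have hfin : V (s + 1) ≠ ⊤ := h'.ne_top (h0 _) hs
      have hUV : U s ≤ V s := by
        rcases hP with hP | ⟨p, -, hP, -⟩
        · exact hP.le
        · exact hP.ge
      obtain ⟨b, hb⟩ := h'.exists_eq_next s (h0 _) (by omega)
      have hbK : b ≠ K s := by
        rintro rfl
        rw [h.val s (h0 _) hse] at hb
        exact absurd (hb ▸ hV) (not_lt.2 hUV)
      rcases h.diff s b with h1 | ⟨i, -, h2, h3, h4, h5⟩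
      · rw [h1] at hb
        have h2 : U (s + 1) ≤ V (s + 1) := by
          rw [← hb]
          exact h.next_le s b (h0 _) hse (by rw [hb]; exact hUV.trans_lt hV)
        have hse' : s + 1 ≤ e := by
          by_contra! hc
          obtain rfl : s = e := by omega
          rw [h.top] at h2
          exact hfin (top_le_iff.1 h2)
        refine ⟨hse', Or.inl (h2.lt_of_ne fun h3 => ?_)⟩
        have h4 : t s (K s) = U (s + 1) := by
          rcases hP with hP | ⟨p, -, -, -, -, hP⟩
          · refine (h.eq_or_eq_next (h0 _) hse).resolve_left fun h4 => ?_
            have h5 := h.special s (h0 _) hse h4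
            rw [h3] at h5
            obtain ⟨x, hx⟩ := WithTop.ne_top_iff_exists.1 (h.ne_top (h0 s) hse)
            obtain ⟨y, hy⟩ := WithTop.ne_top_iff_exists.1 (h'.ne_top (h0 s) (by omega))
            rw [h5, ← hx, ← hy] at hV
            rw [← hx, ← hy] at hP
            have h6 : y < x + 1 := WithTop.coe_lt_coe.1 hV
            have h7 : x < y := WithTop.coe_lt_coe.1 hP
            omega
          · exact hP
        exact hbK (inj h.symInc (by rwa [hb]) (by rw [hb, h4, h3]))
      · rcases h3 with ⟨rfl, h3⟩ | ⟨h3, rfl⟩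
        · exact absurd h3 hbK
        · have hUb : U b = V (s + 1) := h4.symm.trans hb
          have hsb : s < b := h.lt_of_lt (by omega) (h0 _) (by
            rw [hUb]; exact hUV.trans_lt hV)
          rcases hP with hP | ⟨p, h6, -, h7, -⟩
          · rcases (show s + 1 ≤ b from hsb).eq_or_lt with rfl | hlt
            · refine ⟨h2, Or.inr ⟨s, rfl, hUb.symm, h3.symm, hP, ?_⟩⟩
              rw [← h3, h.symInc.symm, h5]
            · exact ⟨by omega, Or.inl (hUb ▸ h.strictMono (h0 _) hlt (by omega))⟩
          · have := h.antitone (h0 _) hsb.le h2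
            omega
  obtain ⟨hfe, hP⟩ := claim f le_rfl
  refine ⟨hfe, (h.antitone (h0 _) hfe le_rfl).trans_lt (h'.symInc'.lt_of_lt (a := f) ?_)⟩
  rw [h'.val f (h0 _) le_rfl]
  have hval := h.val f (h0 _) hfe
  rcases hP with hP | ⟨p, rfl, hVU, hK, hp, -⟩
  · exact (h'.arr_le f (K f)).trans_lt (hval ▸ hP)
  · have hpv := h.val p (h0 _) (by omega)
    have hKp : p ≤ K p := hK.ge.trans (h.anti p (h0 _) (by omega))
    rw [hK, h'.symInc.symm, ← hVU] at hval
    have hV := h'.lt p (h0 _) (by omega)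
    have hL : L p = p + 1 := by
      rcases h'.eq_or_eq_next (h0 p) (by omega) with h1 | h1
      · have h2 := h'.symInc.lt_of_lt (a := p) (b := K p) (c := L p) (by rw [hpv, h1]; exact hp)
        have h3 := h'.symInc.lt_of_lt (a := p) (b := L p) (c := p + 1) (by rwa [hval, h1])
        omega
      · exact inj h'.symInc (by rw [h1]; exact h'.ne_top (h0 _) le_rfl) (h1.trans hval.symm)
    rw [hK, h'.symInc'.symm, ← hL, h'.val p (h0 _) (by omega), hL]
    exact hV

end BumpPath

/-! ## Shifted tableaux as symmetric arrays -/

lemma entry?_eq_getElem? (T : STab) {r c : ℕ} (h : r ≤ c) :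
    entry? T r c = (T.getD r [])[c - r]? := by
  rw [entry?, entryG?, if_pos h, List.getD_eq_getElem?_getD]
  cases T[r]? <;> simp

lemma entry?_eq_none_of_lt (T : STab) {r c : ℕ} (h : c < r) : entry? T r c = none := by
  rw [entry?, entryG?, if_neg (by omega)]

/-- The symmetric array of unprimed entries of a shifted tableau. -/
def toArr (T : STab) : Arr := fun a b =>
  (entry? T (min a b) (max a b)).elim ⊤ fun x => x.ceil

lemma toArr_comm (T : STab) (a b : ℕ) : toArr T a b = toArr T b a := by
  rw [toArr, toArr, min_comm, max_comm]

lemma toArr_of_le (T : STab) {r c : ℕ} (h : r ≤ c) :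
    toArr T r c = (entry? T r c).elim ⊤ fun x => (x.ceil : WithTop ℤ) := by
  rw [toArr, min_eq_left h, max_eq_right h]

lemma toArr_ne_top_iff (T : STab) {r c : ℕ} (h : r ≤ c) :
    toArr T r c ≠ ⊤ ↔ c - r < (T.getD r []).length := by
  rw [toArr_of_le T h, entry?_eq_getElem? T h, ← not_le, ← List.getElem?_eq_none_iff]
  cases (T.getD r [])[c - r]? <;> simp

lemma toArr_eq_top_iff (T : STab) {r c : ℕ} (h : r ≤ c) :
    toArr T r c = ⊤ ↔ (T.getD r []).length ≤ c - r := by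
  rw [← not_iff_not, ← ne_eq, toArr_ne_top_iff T h, not_le]

lemma toArr_eq_symUpdate {T T' : STab} {r₀ c₀ : ℕ} {x : Letter} (h₀ : r₀ ≤ c₀)
    (h : ∀ r c, r ≤ c → entry? T' r c = if r = r₀ ∧ c = c₀ then some x else entry? T r c) :
    toArr T' = symUpdate (toArr T) r₀ c₀ x.ceil := by
  funext a b
  rw [toArr, h _ _ min_le_max]
  by_cases hab : (a = r₀ ∧ b = c₀) ∨ (a = c₀ ∧ b = r₀)
  · rw [if_pos (by omega), symUpdate, if_pos hab]
    rfl
  · rw [if_neg (by omega), symUpdate_of_ne hab, toArr]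

lemma symUpdate_comm (t : Arr) (s k : ℕ) (x : WithTop ℤ) :
    symUpdate t s k x = symUpdate t k s x := by
  funext a b
  unfold symUpdate
  congr 1
  exact propext or_comm

lemma lt_length_of_toArr_ne_top {T : STab} {r c : ℕ} (h : r ≤ c) (hT : toArr T r c ≠ ⊤) :
    r < T.length := by
  rw [toArr_ne_top_iff T h] at hT
  by_contra! hc
  simp [List.getElem?_eq_none hc] at hT

section

variable {α : Type*}

lemma getD_setRowG {T : List (List α)} {r : ℕ} (hr : r ≤ T.length) (row : List α) (r' : ℕ) :
    (setRowG T r row).getD r' [] = if r' = r then row else T.getD r' [] := by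
  rw [setRowG]
  split_ifs with h1 h2 h2
  · subst h2
    simp [h1]
  · simp [List.getElem?_set_ne (Ne.symm h2)]
  · simp [List.getElem?_append_right (show T.length ≤ r' by omega), show r' - T.length = 0 by omega]
  · rcases Nat.lt_or_ge r' T.length with h3 | h3
    · simp [List.getElem?_append_left h3]
    · have h4 : 1 ≤ r' - T.length := by omega
      simp [List.getElem?_append_right h3, List.getElem?_eq_none h3,
        List.getElem?_eq_none (l := [row]) (i := r' - T.length) (by simpa using h4)]

lemma getD_setEntryG (T : List (List α)) (r c : ℕ) (x : α) (r' : ℕ) :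
    (setEntryG T r c x).getD r' [] =
      if r' = r then (T.getD r []).set (c - r) x else T.getD r' [] := by
  rw [setEntryG]
  split_ifs with h
  · subst h
    rcases Nat.lt_or_ge r' T.length with h | h
    · simp [h]
    · rw [List.set_eq_of_length_le h]
      simp [List.getElem?_eq_none h]
  · simp [List.getElem?_set_ne (Ne.symm h)]

lemma setRowG_set {T : List (List α)} {r : ℕ} (hr : r < T.length) (i : ℕ) (x : α) :
    setRowG T r ((T.getD r []).set i x) = setEntryG T r (r + i) x := by
  rw [setRowG, if_pos hr, setEntryG, Nat.add_sub_cancel_left]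

lemma setRowG_set_set {T : List (List α)} {r : ℕ} (hr : r < T.length) (i j : ℕ) (x y : α) :
    setRowG T r (((T.getD r []).set i x).set j y) =
      setEntryG (setEntryG T r (r + i) x) r (r + j) y := by
  rw [setRowG, if_pos hr, setEntryG, getD_setEntryG, if_pos rfl, setEntryG, List.set_set]
  simp

lemma ne_nil_of_mem_setRowG {T : List (List α)} (hT : ∀ row ∈ T, row ≠ []) {r : ℕ} {row : List α}
    (hrow : row ≠ []) : ∀ row' ∈ setRowG T r row, row' ≠ [] := by
  intro row' h
  rw [setRowG] at h
  split_ifs at h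
  · rcases List.mem_or_eq_of_mem_set h with h | rfl
    · exact hT _ h
    · exact hrow
  · rw [List.mem_append, List.mem_singleton] at h
    rcases h with h | rfl
    · exact hT _ h
    · exact hrow

lemma ne_nil_of_mem_setEntryG {T : List (List α)} (hT : ∀ row ∈ T, row ≠ []) {r c : ℕ} {x : α} :
    ∀ row ∈ setEntryG T r c x, row ≠ [] := by
  rcases Nat.lt_or_ge r T.length with hr | hr
  · intro row h
    rw [setEntryG] at h
    rcases List.mem_or_eq_of_mem_set h with h | rfl
    · exact hT _ h
    · rw [ne_eq, List.set_eq_nil_iff, List.getD_eq_getElem?_getD, List.getElem?_eq_getElem hr]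
      exact hT _ (List.getElem_mem hr)
  · rw [setEntryG, List.set_eq_of_length_le hr]
    exact hT

end

lemma toArr_setEntryG {T : STab} {r c : ℕ} (h : r ≤ c) (hT : toArr T r c ≠ ⊤) (x : Letter) :
    toArr (setEntryG T r c x) = symUpdate (toArr T) r c x.ceil := by
  refine toArr_eq_symUpdate h fun r' c' h' => ?_
  rw [toArr_ne_top_iff T h] at hT
  rw [entry?_eq_getElem? _ h', entry?_eq_getElem? _ h', getD_setEntryG]
  by_cases hr : r' = r
  · subst hr
    rw [if_pos rfl, List.getElem?_set, if_pos hT]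
    by_cases hc : c' = c
    · simp [hc]
    · rw [if_neg (by omega), if_neg (by omega)]
  · rw [if_neg hr, if_neg (by omega)]

lemma entry?_append {T : STab} {r : ℕ} (hr : r ≤ T.length) (x : Letter) (r' c' : ℕ) :
    entry? (setRowG T r (T.getD r [] ++ [x])) r' c' =
      if r' = r ∧ c' = r + (T.getD r []).length then some x else entry? T r' c' := by
  rcases Nat.lt_or_ge c' r' with h' | h'
  · rw [entry?_eq_none_of_lt _ h', entry?_eq_none_of_lt _ h', if_neg (by omega)]
  rw [entry?_eq_getElem? _ h', entry?_eq_getElem? _ h', getD_setRowG hr]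
  by_cases h : r' = r
  · subst h
    rw [if_pos rfl]
    by_cases hc : c' = r' + (T.getD r' []).length
    · rw [if_pos ⟨rfl, hc⟩, List.getElem?_append_right (by omega)]
      simp [hc]
    · rw [if_neg (by omega)]
      rcases Nat.lt_or_ge (c' - r') (T.getD r' []).length with h1 | h1
      · rw [List.getElem?_append_left h1]
      · rw [List.getElem?_eq_none (by rw [List.length_append, List.length_singleton]; omega),
          List.getElem?_eq_none h1]
  · rw [if_neg h, if_neg (by omega)]

lemma toArr_append {T : STab} {r : ℕ} (hr : r ≤ T.length) (x : Letter) :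
    toArr (setRowG T r (T.getD r [] ++ [x])) =
      symUpdate (toArr T) r (r + (T.getD r []).length) x.ceil :=
  toArr_eq_symUpdate (by omega) fun r' c' _ => entry?_append hr x r' c'

lemma toArr_setEntryG_setEntryG {T : STab} (hT : SymInc (toArr T)) {r c r' c' : ℕ} (h : r ≤ c)
    (h' : r' ≤ c') {x y : Letter} (hx : toArr T r c = x.ceil) (hy : toArr T r' c' = y.ceil) :
    toArr (setEntryG (setEntryG T r c x) r' c' y) = toArr T := by
  have h1 : toArr (setEntryG T r c x) = toArr T := by
    rw [toArr_setEntryG h (by simp [hx]), symUpdate_eq_self hT hx]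
  rw [toArr_setEntryG h' (by simp [h1, hy]), h1, symUpdate_eq_self hT hy]

lemma ceil_switchPrimes_fst (x y : Letter) : (switchPrimes x y).1.ceil = x.ceil := by
  rw [switchPrimes]
  split_ifs <;> rfl

lemma ceil_switchPrimes_snd (x y : Letter) : (switchPrimes x y).2.ceil = y.ceil := by
  rw [switchPrimes]
  split_ifs <;> rfl

/-! ## Searching a line of a tableau -/

section

variable {α : Type*}

/-- The list `l`, with values given by `g`, lists the finite values of `τ`. -/
def IsReadBy (l : List α) (g : α → ℤ) (τ : ℕ → WithTop ℤ) : Prop :=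
  ∀ i, τ i = l[i]?.elim ⊤ fun x => (g x : WithTop ℤ)

lemma findIdx?_eq_some_of_getElem? {l : List α} {p : α → Bool} {i : ℕ} {x : α}
    (hx : l[i]? = some x) (hp : p x = true) (h : ∀ j < i, ∀ y, l[j]? = some y → p y = false) :
    l.findIdx? p = some i := by
  obtain ⟨hi, rfl⟩ := List.getElem?_eq_some_iff.1 hx
  rw [List.findIdx?_eq_some_iff_getElem]
  exact ⟨hi, hp, fun j hj => by simp [h j hj _ (List.getElem?_eq_getElem (hj.trans hi))]⟩

namespace IsReadBy

variable {l : List α} {g : α → ℤ} {τ : ℕ → WithTop ℤ} (h : IsReadBy l g τ) {i : ℕ} {w w' : ℤ}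
include h

lemma exists_getElem? (hi : τ i = w) : ∃ x, l[i]? = some x ∧ g x = w := by
  rw [h i] at hi
  cases hx : l[i]? with
  | none => simp [hx] at hi
  | some x => exact ⟨x, rfl, by simpa [hx] using hi⟩

lemma value_eq {x : α} (hx : l[i]? = some x) : τ i = g x := by
  rw [h i, hx]
  rfl

lemma length_eq (hk : ∀ b < i, τ b < w) (hi : τ i = ⊤) : l.length = i := by
  apply le_antisymm
  · rw [← List.getElem?_eq_none_iff]
    rw [h i] at hi
    cases hx : l[i]? with
    | none => rfl
    | some x => simp [hx] at hi
  · by_contra! hc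
    have h1 := hk _ hc
    rw [h _] at h1
    simp at h1

lemma findIdx?_eq_none (hk : ∀ b < i, τ b < w) (hi : τ i = ⊤) :
    l.findIdx? (fun x => decide (w < g x)) = none := by
  have hlen := h.length_eq hk hi
  rw [List.findIdx?_eq_none_iff]
  intro x hx
  obtain ⟨j, hj, rfl⟩ := List.getElem_of_mem hx
  have h1 := hk j (hlen ▸ hj)
  rw [h.value_eq (List.getElem?_eq_getElem hj), WithTop.coe_lt_coe] at h1
  simpa using h1.le

lemma findIdx?_le (hk : ∀ b < i, τ b < w) (hi : τ i = w') (hw : w ≤ w') :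
    l.findIdx? (fun x => decide (w ≤ g x)) = some i := by
  obtain ⟨x, hx, rfl⟩ := h.exists_getElem? hi
  refine findIdx?_eq_some_of_getElem? hx (by simpa using hw) fun j hj y hy => ?_
  have h1 := hk j hj
  rw [h.value_eq hy, WithTop.coe_lt_coe] at h1
  simpa using h1

lemma findIdx?_lt (hk : ∀ b < i, τ b ≤ w) (hi : τ i = w') (hw : w < w') :
    l.findIdx? (fun x => decide (w < g x)) = some i := by
  obtain ⟨x, hx, rfl⟩ := h.exists_getElem? hi
  refine findIdx?_eq_some_of_getElem? hx (by simpa using hw) fun j hj y hy => ?_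
  have h1 := hk j hj
  rw [h.value_eq hy, WithTop.coe_le_coe] at h1
  simpa using h1

end IsReadBy

end

lemma isReadBy_row (T : STab) (r : ℕ) :
    IsReadBy (T.getD r []) Letter.ceil fun i => toArr T r (r + i) := by
  intro i
  show toArr T r (r + i) = _
  rw [toArr_of_le T (by omega), entry?_eq_getElem? T (by omega), Nat.add_sub_cancel_left]

lemma getElem?_filterMap_range {α : Type*} {f : ℕ → Option α}
    (hf : ∀ i, f i = none → f (i + 1) = none) (m i : ℕ) :
    ((List.range m).filterMap f)[i]? = if i < m then f i else none := by
  have hf' : ∀ i j, i ≤ j → f i = none → f j = none := by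
    intro i j hij h
    induction j, hij using Nat.le_induction with
    | base => exact h
    | succ j _ ih => exact hf j ih
  induction m generalizing i with
  | zero => simp
  | succ m ih =>
    rw [List.range_succ, List.filterMap_append]
    cases hm : f m with
    | none =>
      simp only [List.filterMap_cons, hm, List.filterMap_nil, List.append_nil, ih]
      split_ifs with h1 h2 h2
      · rfl
      · omega
      · rw [show i = m by omega, hm]
      · rfl
    | some x =>
      have hlen : ((List.range m).filterMap f).length = m := by
        apply le_antisymm
        · rw [← List.getElem?_eq_none_iff, ih, if_neg (lt_irrefl m)]
        · by_contra! hc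
          have h1 := ih ((List.range m).filterMap f).length
          rw [List.getElem?_eq_none le_rfl, if_pos hc] at h1
          have h2 := hf' _ m hc.le h1.symm
          simp [hm] at h2
      simp only [List.filterMap_cons, hm, List.filterMap_nil]
      rcases Nat.lt_trichotomy i m with h1 | rfl | h1
      · rw [List.getElem?_append_left (by omega), ih, if_pos h1, if_pos (by omega)]
      · rw [List.getElem?_append_right (by omega)]
        simp [hlen, hm]
      · rw [List.getElem?_eq_none (by simp [hlen]; omega), if_neg (by omega)]

/-- The boxes of column `c` of a shifted tableau, together with their row indices. -/
def colBoxes (T : STab) (c : ℕ) : List (ℕ × Letter) :=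
  (List.range (c + 1)).filterMap fun r => (entry? T r c).map fun x => (r, x)

lemma getElem?_colBoxes {T : STab} (hT : SymInc (toArr T)) (c i : ℕ) :
    (colBoxes T c)[i]? = (entry? T i c).map fun x => (i, x) := by
  rw [colBoxes, getElem?_filterMap_range]
  · split_ifs with h
    · rfl
    · rw [entry?_eq_none_of_lt T (by omega)]
      rfl
  · intro r hr
    rw [Option.map_eq_none_iff] at hr ⊢
    rcases Nat.lt_or_ge c (r + 1) with h | h
    · exact entry?_eq_none_of_lt T h
    · have h1 := hT.col_le (c := c) (Nat.le_succ r)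
      rw [toArr_of_le T h, toArr_of_le T (by omega), hr] at h1
      cases h2 : entry? T (r + 1) c with
      | none => rfl
      | some x => simp [h2] at h1

lemma isReadBy_colBoxes {T : STab} (hT : SymInc (toArr T)) (c : ℕ) :
    IsReadBy (colBoxes T c) (fun p => p.2.ceil) fun i => if i ≤ c then toArr T c i else ⊤ := by
  intro i
  show (if i ≤ c then toArr T c i else ⊤) = _
  rw [getElem?_colBoxes hT]
  split_ifs with h
  · rw [toArr_comm, toArr_of_le T h]
    cases entry? T i c <;> rfl
  · rw [entry?_eq_none_of_lt T (by omega)]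
    rfl

/-! ## Insertion into a tableau as a bumping path -/

/-- The pair `out` is a tableau obtained from `T` by inserting `w` into line `s` along a bumping
path which ends in line `e`, together with a flag telling whether the insertion ended in a column. -/
structure IsInsertion (T : STab) (n B s j : ℕ) (w : ℤ) (rest : List ℤ) (out : STab × Bool)
    (e : ℕ) (U : ℕ → WithTop ℤ) (K : ℕ → ℕ) : Prop where
  ne_nil : ∀ row ∈ out.1, row ≠ []
  path : BumpPath (toArr T) (toArr out.1) s e U K
  start : U s = w
  col_le : K s ≤ j
  line_le : e ≤ n
  last_le : out.2 = true → K e ≤ e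
  le_last : out.2 = false → e ≤ K e
  reduced : InvReduced (reading (toArr out.1) 0 B 0 B ++ rest)

namespace IsInsertion

variable {T T₁ : STab} {n B s j k e : ℕ} {w w' : ℤ} {rest : List ℤ} {out : STab × Bool}
  {U : ℕ → WithTop ℤ} {K : ℕ → ℕ}

lemma single (hout : ∀ row ∈ out.1, row ≠ []) (hT : SymInc (toArr T))
    (hT' : SymInc (symUpdate (toArr T) s k w)) (htop : toArr T s k = ⊤)
    (hk : ∀ b < k, toArr T s b < w) (h : toArr out.1 = symUpdate (toArr T) s k w) (hkj : k ≤ j)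
    (hsn : s ≤ n) (h1 : out.2 = true → k ≤ s) (h2 : out.2 = false → s ≤ k)
    (hred : InvReduced (reading (symUpdate (toArr T) s k w) 0 B 0 B ++ rest)) :
    IsInsertion T n B s j w rest out s (fun i => if i ≤ s then w else ⊤) fun _ => k where
  ne_nil := hout
  path := h ▸ BumpPath.single hT hT' hk htop
  start := if_pos le_rfl
  col_le := hkj
  line_le := hsn
  last_le := h1
  le_last := h2
  reduced := h ▸ hred

lemma cons (hT : SymInc (toArr T)) (hk : ∀ b < k, toArr T s b < w)
    (hT₁ : toArr T₁ = symUpdate (toArr T) s k w) (hkj : k ≤ j)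
    (hw' : (toArr T s k = w' ∧ w < w') ∨
      (toArr T s k = w ∧ w' = w + 1 ∧ toArr T s (k + 1) = w'))
    (h : IsInsertion T₁ n B (s + 1) k w' rest out e U K) :
    IsInsertion T n B s j w rest out e (Function.update U s w) (Function.update K s k) := by
  have hes : e ≠ s := by
    have := h.path.le
    omega
  have hpath := h.path
  rw [hT₁] at hpath
  exact
    { ne_nil := h.ne_nil
      path := hpath.cons hT hk hw' h.start h.col_le
      start := Function.update_self ..
      col_le := by simpa using hkj
      line_le := h.line_le
      last_le := by simpa [hes] using h.last_le
      le_last := by simpa [hes] using h.le_last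
      reduced := h.reduced }

end IsInsertion

/-! ### Column insertion -/

section

variable {T : STab} {c k : ℕ} {w m M : Letter} (fuel : ℕ)

lemma egCol_eq_append
    (hM : (colBoxes T c).findIdx? (fun p => decide (w.ceil < p.2.ceil)) = none)
    (hlen : (colBoxes T c).length = k) (hk : k ≠ c) :
    egCol (fuel + 1) T c w = (setRowG T k (T.getD k [] ++ [w]), true) := by
  rw [egCol]
  unfold colBoxes at hM hlen
  simp only [hM, hlen, hk, false_and, if_false]

lemma egCol_eq_bump
    (hM : (colBoxes T c).findIdx? (fun p => decide (w.ceil < p.2.ceil)) = some k)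
    (hm : (colBoxes T c).findIdx? (fun p => decide (w.ceil ≤ p.2.ceil)) = some k)
    (hkm : (colBoxes T c)[k]? = some (k, m)) (hk : k ≠ c) :
    egCol (fuel + 1) T c w = egCol fuel (setEntryG T k c w) (c + 1) m := by
  rw [egCol]
  unfold colBoxes at hM hm hkm
  simp only [hM, hm, List.getD_eq_getElem?_getD, hkm, Option.getD_some, if_true, hk, if_false]

lemma egCol_eq_switch
    (hM : (colBoxes T c).findIdx? (fun p => decide (w.ceil < p.2.ceil)) = some (k + 1))
    (hm : (colBoxes T c).findIdx? (fun p => decide (w.ceil ≤ p.2.ceil)) = some k)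
    (hkm : (colBoxes T c)[k]? = some (k, m)) (hkM : (colBoxes T c)[k + 1]? = some (k + 1, M)) :
    egCol (fuel + 1) T c w =
      egCol fuel (setEntryG (setEntryG T k c (switchPrimes m M).1) (k + 1) c (switchPrimes m M).2)
        (c + 1) w.succL := by
  rw [egCol]
  unfold colBoxes at hM hm hkm hkM
  simp only [hM, hm, List.getD_eq_getElem?_getD, hkm, hkM, Option.getD_some,
    show k ≠ k + 1 by omega, if_false]

end

/-- An insertion which has entered column mode follows a bumping path. -/
lemma exists_isInsertion_egCol {n B : ℕ} {rest : List ℤ} (fuel : ℕ) {T : STab} {s j : ℕ}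
    {w : Letter} (hT : ∀ row ∈ T, row ≠ []) (h : InsertState (toArr T) n B s j w.ceil rest)
    (hjs : j < s) (hfuel : n + 1 ≤ fuel + s) :
    ∃ e U K, IsInsertion T n B s j w.ceil rest (egCol fuel T s w) e U K ∧
      (egCol fuel T s w).2 = true := by
  induction fuel generalizing T s j w with
  | zero =>
    have := h.line_le
    omega
  | succ fuel ih =>
    obtain ⟨k, hkj, -, hk, hle, hsym, hcases⟩ := h.step
    have hread := isReadBy_colBoxes h.symInc s
    have hτ : ∀ i ≤ s, (if i ≤ s then toArr T s i else ⊤) = toArr T s i := fun i hi => if_pos hi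
    have hk' : ∀ b < k, (if b ≤ s then toArr T s b else ⊤) < (w.ceil : WithTop ℤ) := by
      intro b hb
      rw [hτ b (by omega)]
      exact hk b hb
    have hbox : ∀ (i : ℕ) (x : ℤ), i ≤ s → toArr T s i = x →
        ∃ m, (colBoxes T s)[i]? = some (i, m) ∧ m.ceil = x := by
      intro i x hi hx
      obtain ⟨⟨i', m⟩, h1, h2⟩ := hread.exists_getElem? (i := i) (by rw [hτ i hi, hx])
      have h3 := getElem?_colBoxes h.symInc s i
      rw [h1] at h3
      cases h4 : entry? T i s with
      | none => simp [h4] at h3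
      | some y =>
        simp only [h4, Option.map_some, Option.some.injEq, Prod.mk.injEq] at h3
        exact ⟨m, by rw [h1, h3.1], h2⟩
    rcases hcases with ⟨htop, hred⟩ | ⟨w', hw', hstate⟩
    · have htop' : (if k ≤ s then toArr T s k else ⊤) = ⊤ := by rw [hτ k (by omega), htop]
      obtain ⟨s', rfl⟩ : ∃ s', s = s' + 1 := ⟨s - 1, by omega⟩
      have hprev : toArr T k s' ≠ ⊤ := by
        rw [toArr_comm]
        exact ((h.symInc.row_le hkj).trans_lt (h.lt s' rfl)).ne_top
      have hlen : (T.getD k []).length = s' + 1 - k := by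
        have h1 := (toArr_ne_top_iff T (by omega)).1 hprev
        have h2 := (toArr_eq_top_iff T (by omega)).1 ((toArr_comm T k (s' + 1)).trans htop)
        omega
      have hkT := lt_length_of_toArr_ne_top (by omega) hprev
      rw [egCol_eq_append fuel (hread.findIdx?_eq_none hk' htop') (hread.length_eq hk' htop')
        (by omega)]
      refine ⟨_, _, _, IsInsertion.single (ne_nil_of_mem_setRowG hT (by simp)) h.symInc hsym htop hk
        ?_ hkj h.line_le (fun _ => by omega) (by simp) hred, rfl⟩
      rw [toArr_append hkT.le, hlen, show k + (s' + 1 - k) = s' + 1 by omega, symUpdate_comm]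
    · rcases hw' with ⟨h1, h2⟩ | ⟨h1, rfl, h2⟩
      · obtain ⟨m, hm, rfl⟩ := hbox k w' (by omega) h1
        have h1' : (if k ≤ s then toArr T s k else ⊤) = m.ceil := by rw [hτ k (by omega), h1]
        rw [egCol_eq_bump fuel (hread.findIdx?_lt (fun b hb => (hk' b hb).le) h1' h2)
          (hread.findIdx?_le hk' h1' h2.le) hm (by omega)]
        have hT₁ : toArr (setEntryG T k s w) = symUpdate (toArr T) s k w.ceil := by
          rw [toArr_setEntryG (by omega) (by rw [toArr_comm, h1]; exact WithTop.coe_ne_top),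
            symUpdate_comm]
        obtain ⟨e, U, K, h3, h4⟩ := ih (ne_nil_of_mem_setEntryG hT) (hT₁ ▸ hstate) (by omega)
          (by omega)
        exact ⟨e, _, _, h3.cons h.symInc hk hT₁ hkj (Or.inl ⟨h1, h2⟩), h4⟩
      · obtain ⟨m, hm, hmw⟩ := hbox k _ (by omega) h1
        obtain ⟨M, hM, hMw⟩ := hbox (k + 1) _ (by omega) h2
        have h1' : (if k ≤ s then toArr T s k else ⊤) = w.ceil := by rw [hτ k (by omega), h1]
        have h2' : (if k + 1 ≤ s then toArr T s (k + 1) else ⊤) = (w.ceil + 1 : ℤ) := by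
          rw [hτ _ (by omega), h2]
        rw [egCol_eq_switch fuel (hread.findIdx?_lt (fun b hb => ?_) h2' (by omega))
          (hread.findIdx?_le hk' h1' le_rfl) hm hM]
        · have hT₁ : toArr (setEntryG (setEntryG T k s (switchPrimes m M).1) (k + 1) s
              (switchPrimes m M).2) = symUpdate (toArr T) s k w.ceil := by
            rw [symUpdate_eq_self h.symInc h1]
            apply toArr_setEntryG_setEntryG h.symInc (by omega) (by omega)
            · rw [toArr_comm, h1, ceil_switchPrimes_fst, hmw]
            · rw [toArr_comm, h2, ceil_switchPrimes_snd, hMw]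
          obtain ⟨e, U, K, h3, h4⟩ := ih (w := w.succL)
            (ne_nil_of_mem_setEntryG (ne_nil_of_mem_setEntryG hT)) (hT₁ ▸ hstate) (by omega)
            (by omega)
          exact ⟨e, _, _, h3.cons h.symInc hk hT₁ hkj (Or.inr ⟨h1, rfl, h2⟩), h4⟩
        · rcases Nat.lt_succ_iff_lt_or_eq.1 hb with h3 | rfl
          · exact (hk' b h3).le
          · exact h1'.le

/-! ### Row insertion -/

section

variable {T : STab} {r k : ℕ} {w m M : Letter} (fuel : ℕ)

lemma egRow_eq_append
    (hM : (T.getD r []).findIdx? (fun x => decide (w.ceil < x.ceil)) = none) :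
    ∃ x flag, egRow (fuel + 1) T r w = (setRowG T r (T.getD r [] ++ [x]), flag) ∧
      x.ceil = w.ceil ∧ (flag = true → T.getD r [] = []) := by
  rw [egRow]
  simp only [hM]
  split_ifs with h
  · have h1 := List.isEmpty_iff.1 h.1
    exact ⟨w.unprime, true, by rw [h1]; rfl, rfl, fun _ => h1⟩
  · exact ⟨w, false, rfl, rfl, by simp⟩

lemma egRow_eq_bump
    (hr : r < T.length)
    (hM : (T.getD r []).findIdx? (fun x => decide (w.ceil < x.ceil)) = some k)
    (hm : (T.getD r []).findIdx? (fun x => decide (w.ceil ≤ x.ceil)) = some k)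
    (hkm : (T.getD r [])[k]? = some m) :
    ∃ x y, x.ceil = w.ceil ∧ y.ceil = m.ceil ∧ egRow (fuel + 1) T r w =
      if k = 0 then egCol fuel (setEntryG T r (r + k) x) (r + 1) y
      else egRow fuel (setEntryG T r (r + k) x) (r + 1) y := by
  rw [egRow]
  simp only [hM, hm, List.getD_eq_getElem?_getD (l := T.getD r []), hkm, Option.getD_some, if_true]
  split_ifs with h
  · subst h
    exact ⟨w.unprime, ⟨m.ceil, w.primed⟩, rfl, rfl, by rw [setRowG_set hr]⟩
  · exact ⟨w, m, rfl, rfl, by rw [setRowG_set hr]⟩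

lemma egRow_eq_switch
    (hr : r < T.length)
    (hM : (T.getD r []).findIdx? (fun x => decide (w.ceil < x.ceil)) = some (k + 1))
    (hm : (T.getD r []).findIdx? (fun x => decide (w.ceil ≤ x.ceil)) = some k)
    (hkm : (T.getD r [])[k]? = some m) (hkM : (T.getD r [])[k + 1]? = some M) :
    egRow (fuel + 1) T r w =
      if k = 0 then egCol fuel (setEntryG (setEntryG T r (r + k) (switchPrimes m M).1)
        r (r + (k + 1)) (switchPrimes m M).2) (r + 1) w.succL
      else egRow fuel (setEntryG (setEntryG T r (r + k) (switchPrimes m M).1)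
        r (r + (k + 1)) (switchPrimes m M).2) (r + 1) w.succL := by
  rw [egRow, ← setRowG_set_set hr]
  simp only [hM, hm, List.getD_eq_getElem?_getD (l := T.getD r []), hkm, hkM, Option.getD_some,
    show k ≠ k + 1 by omega, if_false]

end

/-- An insertion follows a bumping path. -/
lemma exists_isInsertion_egRow {n B : ℕ} {rest : List ℤ} (fuel : ℕ) {T : STab} {s j : ℕ}
    {w : Letter} (hT : ∀ row ∈ T, row ≠ []) (h : InsertState (toArr T) n B s j w.ceil rest)
    (hjs : s ≤ j) (hfuel : n + 1 ≤ fuel + s) :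
    ∃ e U K, IsInsertion T n B s j w.ceil rest (egRow fuel T s w) e U K := by
  induction fuel generalizing T s j w with
  | zero =>
    have := h.line_le
    omega
  | succ fuel ih =>
    obtain ⟨k, hkj, hsk, hk, hle, hsym, hcases⟩ := h.step
    obtain ⟨i, rfl⟩ : ∃ i, k = s + i := ⟨k - s, by have := hsk hjs; omega⟩
    have hread := isReadBy_row T s
    have hk' : ∀ b < i, toArr T s (s + b) < w.ceil := fun b hb => hk _ (by omega)
    rcases hcases with ⟨htop, hred⟩ | ⟨w', hw', hstate⟩
    · have hsT : s ≤ T.length := by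
        rcases s with _ | s
        · exact Nat.zero_le _
        · exact lt_length_of_toArr_ne_top (c := j) (by omega) (h.lt s rfl).ne_top
      obtain ⟨x, flag, h1, h2, h3⟩ := egRow_eq_append fuel (hread.findIdx?_eq_none hk' htop)
      have hlen := hread.length_eq hk' htop
      rw [h1]
      refine ⟨_, _, _, IsInsertion.single (ne_nil_of_mem_setRowG hT (by simp)) h.symInc hsym htop hk
        ?_ hkj h.line_le (fun hf => ?_) (fun _ => by omega) hred⟩
      · rw [toArr_append hsT, hlen, h2]
      · rw [h3 hf] at hlen
        simp at hlen
        omega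
    · have hsT : s < T.length := by
        refine lt_length_of_toArr_ne_top (c := s + i) (by omega) ?_
        rcases hw' with h1 | h1 <;> rw [h1.1] <;> exact WithTop.coe_ne_top
      have hstep : ∀ {T₁ : STab} {y : Letter}, (∀ row ∈ T₁, row ≠ []) →
          toArr T₁ = symUpdate (toArr T) s (s + i) w.ceil → y.ceil = w' →
          ∃ e U K, IsInsertion T n B s j w.ceil rest
            (if i = 0 then egCol fuel T₁ (s + 1) y else egRow fuel T₁ (s + 1) y) e U K := by
        intro T₁ y hne hT₁ hy
        subst hy
        rw [← hT₁] at hstate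
        split_ifs with hi
        · obtain ⟨e, U, K, h3, -⟩ := exists_isInsertion_egCol fuel hne hstate (by omega) (by omega)
          exact ⟨e, _, _, h3.cons h.symInc hk hT₁ hkj hw'⟩
        · obtain ⟨e, U, K, h3⟩ := ih hne hstate (by omega) (by omega)
          exact ⟨e, _, _, h3.cons h.symInc hk hT₁ hkj hw'⟩
      rcases hw' with ⟨h1, h2⟩ | ⟨h1, rfl, h2⟩
      · obtain ⟨m, hm, rfl⟩ := hread.exists_getElem? h1
        obtain ⟨x, y, hx, hy, heq⟩ := egRow_eq_bump fuel hsT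
          (hread.findIdx?_lt (fun b hb => (hk' b hb).le) h1 h2) (hread.findIdx?_le hk' h1 h2.le) hm
        rw [heq]
        refine hstep (ne_nil_of_mem_setEntryG hT) ?_ hy
        rw [toArr_setEntryG (by omega) (by rw [h1]; exact WithTop.coe_ne_top), hx]
      · obtain ⟨m, hm, hmw⟩ := hread.exists_getElem? h1
        obtain ⟨M, hM, hMw⟩ := hread.exists_getElem? (i := i + 1) h2
        rw [egRow_eq_switch fuel hsT (hread.findIdx?_lt (fun b hb => ?_) (i := i + 1) h2 (by omega))
          (hread.findIdx?_le hk' h1 le_rfl) hm hM]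
        · refine hstep (ne_nil_of_mem_setEntryG (ne_nil_of_mem_setEntryG hT)) ?_ rfl
          rw [symUpdate_eq_self h.symInc h1]
          apply toArr_setEntryG_setEntryG h.symInc (by omega) (by omega)
          · rw [h1, ceil_switchPrimes_fst, hmw]
          · rw [ceil_switchPrimes_snd, hMw]
            exact h2
        · rcases Nat.lt_succ_iff_lt_or_eq.1 hb with h3 | rfl
          · exact (hk' b h3).le
          · exact h1.le

/-! ## Insertion and recording tableaux of a word -/

lemma toArr_eq_top_of_numCols_le {T : STab} (hT : SymInc (toArr T)) (a : ℕ) {b : ℕ}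
    (h : numCols T ≤ b) : toArr T a b = ⊤ := by
  have h1 : toArr T 0 b = ⊤ := (toArr_eq_top_iff T (Nat.zero_le b)).2 h
  exact top_unique (h1 ▸ hT.col_le (Nat.zero_le a))

lemma numCols_le_length_flatten {α : Type*} (T : List (List α)) : numCols T ≤ T.flatten.length := by
  cases T <;> simp [numCols]

lemma exists_isInsertion_egInsert {T : STab} {B : ℕ} {u : Letter} {rest : List ℤ}
    (hne : ∀ row ∈ T, row ≠ []) (hT : SymInc (toArr T)) (hB : numCols T + 1 < B)
    (hred : InvReduced (reading (toArr T) 0 B 0 B ++ u.ceil :: rest)) :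
    ∃ e U K, IsInsertion T (numCols T) B 0 (numCols T) u.ceil rest (egInsert T u) e U K := by
  refine exists_isInsertion_egRow _ hne ?_ (Nat.zero_le _) ?_
  · exact
      { symInc := hT
        supp := fun a b h => toArr_eq_top_of_numCols_le hT a h
        lt_bound := hB
        line_le := Nat.zero_le _
        col_le := le_rfl
        le := by rw [toArr_eq_top_of_numCols_le hT 0 le_rfl]; exact le_top
        lt := by omega
        reduced := by
          have h1 : reading (toArr T) 0 0 0 B = [] := by simp [reading]
          simpa [stateWord, h1] using hred }
  · have := numCols_le_length_flatten T
    omega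

lemma IsInsertion.numCols_le {T : STab} {B : ℕ} {w : ℤ} {rest : List ℤ} {out : STab × Bool} {e : ℕ}
    {U : ℕ → WithTop ℤ} {K : ℕ → ℕ}
    (h : IsInsertion T (numCols T) B 0 (numCols T) w rest out e U K) :
    numCols out.1 ≤ numCols T + 1 := by
  have h1 : toArr out.1 0 (numCols T + 1) = ⊤ := by
    by_contra hne
    have h2 := h.line_le
    have h3 := h.path.antitone le_rfl (Nat.zero_le e) le_rfl
    have h4 := h.col_le
    rcases (h.path.ne_top_iff _ _).1 hne with h5 | h5 | h5
    · exact h5 (toArr_eq_top_of_numCols_le h.path.symInc 0 (by omega))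
    · omega
    · omega
  exact (toArr_eq_top_iff out.1 (Nat.zero_le _)).1 h1

lemma PEG_append_singleton (l : PWord) (u : Letter) : PEG (l ++ [u]) = (egInsert (PEG l) u).1 := by
  simp [PEG]

lemma PEG_properties (B : ℕ) (l : PWord) (rest : List ℤ) (hB : l.length < B)
    (hred : InvReduced (unprimeWord l ++ rest)) :
    (∀ row ∈ PEG l, row ≠ []) ∧ SymInc (toArr (PEG l)) ∧ numCols (PEG l) ≤ l.length ∧
      InvReduced (reading (toArr (PEG l)) 0 B 0 B ++ rest) := by
  induction l using List.reverseRecOn generalizing rest with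
  | nil =>
    have h0 : ∀ a b, toArr (PEG []) a b = ⊤ := fun a b => by
      simp [toArr, PEG, entry?, entryG?]
    refine ⟨by simp [PEG], ⟨fun a b => by rw [h0, h0], fun a b => Or.inl (h0 _ _)⟩,
      by simp [PEG, numCols], ?_⟩
    rwa [reading_eq_nil fun r c _ _ _ _ _ => h0 r c]
  | append_singleton l u ih =>
    rw [List.length_append, List.length_singleton] at hB
    obtain ⟨h1, h2, h3, h4⟩ := ih (u.ceil :: rest) (by omega)
      (by simpa [unprimeWord] using hred)
    obtain ⟨e, U, K, h⟩ := exists_isInsertion_egInsert h1 h2 (by omega) h4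
    rw [PEG_append_singleton, List.length_append, List.length_singleton]
    exact ⟨h.ne_nil, h.path.symInc', h.numCols_le.trans (by omega), h.reduced⟩

lemma exists_isInsertion_PEG {a : PWord} (hred : InvReduced (unprimeWord a)) {k : ℕ}
    (hk : k < a.length) :
    ∃ n B rest e U K, IsInsertion (PEG (a.take k)) n B 0 n a[k].ceil rest
      (egInsert (PEG (a.take k)) a[k]) e U K := by
  have hk' : (a.take k).length = k := by simp [hk.le]
  obtain ⟨h1, h2, h3, h4⟩ := PEG_properties (k + 2) (a.take k) (a[k].ceil ::
    unprimeWord (a.drop (k + 1))) (by omega) (by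
      rw [unprimeWord, unprimeWord, ← List.map_cons (f := Letter.ceil), ← List.map_append,
        ← List.drop_eq_getElem_cons hk, List.take_append_drop]
      exact hred)
  obtain ⟨e, U, K, h⟩ := exists_isInsertion_egInsert h1 h2 (by omega) h4
  exact ⟨_, _, _, e, U, K, h⟩

lemma PEG_take_succ {a : PWord} {k : ℕ} (hk : k < a.length) :
    PEG (a.take (k + 1)) = (egInsert (PEG (a.take k)) a[k]).1 := by
  rw [List.take_succ_eq_append_getElem hk, PEG_append_singleton]

lemma QEGaux_append_singleton (P Q : STab) (n : ℕ) (l : PWord) (u : Letter) :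
    QEGaux P Q n (l ++ [u]) =
      let P' := l.foldl (fun T u => (egInsert T u).1) P
      addBox (QEGaux P Q n l) P' (egInsert P' u).1 ⟨(n + l.length : ℕ), (egInsert P' u).2⟩ := by
  induction l generalizing P Q n with
  | nil => rfl
  | cons x l ih =>
    rw [List.cons_append, QEGaux, ih, List.foldl_cons, List.length_cons, QEGaux, Nat.add_right_comm,
      Nat.add_assoc]

lemma QEG_take_succ {a : PWord} {k : ℕ} (hk : k < a.length) :
    QEG (a.take (k + 1)) = addBox (QEG (a.take k)) (PEG (a.take k)) (PEG (a.take (k + 1)))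
      ⟨(k + 1 : ℕ), (egInsert (PEG (a.take k)) a[k]).2⟩ := by
  rw [PEG_take_succ hk, List.take_succ_eq_append_getElem hk, QEG, QEGaux_append_singleton,
    List.length_take_of_le hk.le, Nat.add_comm 1]
  rfl

/-- The shape of `P'` is the shape of `P` with the box in row `r` and column `c` added. -/
structure AddsBox (P P' : STab) (r c : ℕ) : Prop where
  col_eq : c = r + (P.getD r []).length
  length_eq : ∀ r', (P'.getD r' []).length = (P.getD r' []).length + if r' = r then 1 else 0
  prev_pos : ∀ r', r = r' + 1 → 0 < (P.getD r' []).length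

lemma AddsBox.addBox_eq {P P' : STab} {r c : ℕ} (h : AddsBox P P' r c) (Q : STab) (x : Letter) :
    addBox Q P P' x = setRowG Q r (Q.getD r [] ++ [x]) := by
  have h1 : (List.range P'.length).find?
      (fun r' => decide ((P.getD r' []).length ≠ (P'.getD r' []).length)) = some r := by
    rw [List.find?_range_eq_some]
    refine ⟨by rw [h.length_eq, if_pos rfl]; simp, ?_, fun r' hr' => by
      rw [h.length_eq, if_neg hr'.ne]
      simp⟩
    rw [List.mem_range]
    by_contra! hc
    have h2 := h.length_eq r
    simp [List.getElem?_eq_none hc] at h2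
  rw [addBox, h1]

lemma IsInsertion.addsBox {T : STab} {n B s j : ℕ} {w : ℤ} {rest : List ℤ} {out : STab × Bool}
    {e : ℕ} {U : ℕ → WithTop ℤ} {K : ℕ → ℕ} (h : IsInsertion T n B s j w rest out e U K) :
    AddsBox T out.1 (min e (K e)) (max e (K e)) := by
  set r := min e (K e)
  set c := max e (K e)
  have hrc : r ≤ c := min_le_max
  have hshape : ∀ a b, a ≤ b → (b - a < (out.1.getD a []).length ↔
      b - a < (T.getD a []).length ∨ (a = r ∧ b = c)) := by
    intro a b hab
    rw [← toArr_ne_top_iff _ hab, ← toArr_ne_top_iff _ hab, h.path.ne_top_iff]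
    refine or_congr_right ?_
    omega
  have hold : (T.getD r []).length ≤ c - r := by
    have h1 := h.path.last_eq_top
    rw [← toArr_eq_top_iff T hrc]
    rcases le_total e (K e) with h2 | h2
    · rwa [show r = e from min_eq_left h2, show c = K e from max_eq_right h2]
    · rwa [show r = K e from min_eq_right h2, show c = e from max_eq_left h2, toArr_comm]
  have hcol : c - r = (T.getD r []).length := by
    refine le_antisymm ?_ hold
    by_contra! hc
    have h1 := (hshape r c hrc).2 (Or.inr ⟨rfl, rfl⟩)
    have h2 := (hshape r (r + (T.getD r []).length) (by omega)).1 (by omega)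
    omega
  refine ⟨by omega, fun r' => ?_, ?_⟩
  · have h1 := hshape r' (r' + (T.getD r' []).length) (by omega)
    have h2 := hshape r' (r' + (T.getD r' []).length + 1) (by omega)
    have h3 := fun i => hshape r' (r' + i) (by omega)
    rw [Nat.add_sub_cancel_left] at h1
    split_ifs with h4
    · subst h4
      omega
    · have h5 := hshape r' (r' + (out.1.getD r' []).length) (by omega)
      omega
  · intro r' hr'
    have h1 : toArr out.1 r c ≠ ⊤ :=
      (toArr_ne_top_iff _ hrc).2 ((hshape r c hrc).2 (Or.inr ⟨rfl, rfl⟩))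
    have h2 := (hshape r' c (by omega)).1 ((toArr_ne_top_iff _ (by omega)).1 fun h3 =>
      h1 (top_unique (h3 ▸ h.path.symInc'.col_le (by omega))))
    omega

/-- The recording tableau contains the number `k + 1` in the box added by the insertion of the
letter with index `k`. -/
lemma QEG_take_properties {a : PWord} {R C : ℕ → ℕ} {F : ℕ → Bool}
    (hbox : ∀ k, k < a.length → AddsBox (PEG (a.take k)) (PEG (a.take (k + 1))) (R k) (C k))
    (hF : ∀ (k : ℕ) (hk : k < a.length), (egInsert (PEG (a.take k)) a[k]).2 = F k) {n : ℕ}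
    (hn : n ≤ a.length) :
    (∀ r, ((QEG (a.take n)).getD r []).length = ((PEG (a.take n)).getD r []).length) ∧
    ∀ r c x, entry? (QEG (a.take n)) r c = some x ↔
      ∃ k < n, r = R k ∧ c = C k ∧ x = ⟨(k + 1 : ℕ), F k⟩ := by
  induction n with
  | zero => simp [QEG, QEGaux, PEG, entry?, entryG?]
  | succ n ih =>
    obtain ⟨ih1, ih2⟩ := ih (by omega)
    have h := hbox n hn
    have hR : R n ≤ (QEG (a.take n)).length := by
      rcases hr : R n with _ | r
      · exact Nat.zero_le _
      · have h1 := h.prev_pos r hr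
        rw [← ih1] at h1
        by_contra! hc
        simp [List.getElem?_eq_none (show (QEG (a.take n)).length ≤ r by omega)] at h1
    rw [QEG_take_succ hn, h.addBox_eq, hF n hn]
    refine ⟨fun r => ?_, fun r c x => ?_⟩
    · rw [getD_setRowG hR, h.length_eq]
      split_ifs with h1
      · rw [h1, List.length_append, ih1, List.length_singleton]
      · rw [ih1, Nat.add_zero]
    · rw [entry?_append hR, ih1, ← h.col_eq]
      have hnone : ∀ y, entry? (QEG (a.take n)) (R n) (C n) ≠ some y := by
        intro y hy
        rw [entry?_eq_getElem? _ (by have := h.col_eq; omega)] at hy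
        have h1 := (List.getElem?_eq_some_iff.1 hy).1
        have := h.col_eq
        rw [ih1] at h1
        omega
      constructor
      · intro hx
        split_ifs at hx with h1
        · exact ⟨n, by omega, h1.1, h1.2, (Option.some.inj hx).symm⟩
        · obtain ⟨k, h2, h3⟩ := (ih2 r c x).1 hx
          exact ⟨k, by omega, h3⟩
      · rintro ⟨k, hk, hr, hc, hx⟩
        rcases Nat.lt_succ_iff_lt_or_eq.1 hk with h1 | rfl
        · have h2 := (ih2 r c x).2 ⟨k, h1, hr, hc, hx⟩
          rw [if_neg, h2]
          rintro ⟨rfl, rfl⟩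
          exact hnone x h2
        · rw [if_pos ⟨hr, hc⟩, hx]

lemma mem_DesT_QEG_iff {a : PWord} {R C : ℕ → ℕ} {F : ℕ → Bool}
    (hbox : ∀ k, k < a.length → AddsBox (PEG (a.take k)) (PEG (a.take (k + 1))) (R k) (C k))
    (hF : ∀ (k : ℕ) (hk : k < a.length), (egInsert (PEG (a.take k)) a[k]).2 = F k) (i : ℤ) :
    i ∈ DesT (QEG a) ↔ ∃ k : ℕ, i = k + 1 ∧ k + 1 < a.length ∧
      ((F k = false ∧ F (k + 1) = false ∧ R k < R (k + 1)) ∨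
        (F k = true ∧ F (k + 1) = true ∧ C k < C (k + 1)) ∨ (F k = false ∧ F (k + 1) = true)) := by
  have hent := (QEG_take_properties hbox hF le_rfl).2
  rw [List.take_length] at hent
  have hent' : ∀ r c (i : ℤ) b, entry? (QEG a) r c = some ⟨i, b⟩ ↔
      ∃ k < a.length, r = R k ∧ c = C k ∧ i = k + 1 ∧ b = F k := by
    intro r c i b
    rw [hent]
    simp
  constructor
  · rintro ⟨-, ⟨r, c, r', c', h1, h2, h3⟩ | ⟨r, c, r', c', h1, h2, h3⟩ | ⟨r, c, r', c', h1, h2⟩⟩ <;>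
    · obtain ⟨k, hk, rfl, rfl, rfl, hb⟩ := (hent' ..).1 h1
      obtain ⟨l, hl, rfl, rfl, hkl, hb'⟩ := (hent' ..).1 h2
      obtain rfl : l = k + 1 := by omega
      exact ⟨k, rfl, hl, by simp_all⟩
  · rintro ⟨k, rfl, hk, h⟩
    have h1 : entry? (QEG a) (R k) (C k) = some ⟨k + 1, F k⟩ :=
      (hent' ..).2 ⟨k, by omega, rfl, rfl, rfl, rfl⟩
    have h2 : entry? (QEG a) (R (k + 1)) (C (k + 1)) = some ⟨k + 1 + 1, F (k + 1)⟩ :=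
      (hent' ..).2 ⟨k + 1, hk, rfl, rfl, by push_cast; rfl, rfl⟩
    refine ⟨by omega, ?_⟩
    rcases h with ⟨h3, h4, h5⟩ | ⟨h3, h4, h5⟩ | ⟨h3, h4⟩ <;> rw [h3] at h1 <;> rw [h4] at h2
    · exact Or.inl ⟨_, _, _, _, h1, h2, h5⟩
    · exact Or.inr (Or.inl ⟨_, _, _, _, h1, h2, h5⟩)
    · exact Or.inr (Or.inr ⟨_, _, _, _, h1, h2⟩)

/-! ## Comparison of descents -/

lemma Letter.lt_iff_ceil_lt {x y : Letter} (h : x.ceil ≠ y.ceil) : x < y ↔ x.ceil < y.ceil := by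
  change toLex (x.ceil, !x.primed) < toLex (y.ceil, !y.primed) ↔ _
  rw [Prod.Lex.toLex_lt_toLex]
  simp [h]

lemma ceil_getElem_ne_ceil_getElem_succ {a : PWord} (hred : InvReduced (unprimeWord a)) {k : ℕ}
    (hk : k + 1 < a.length) : a[k].ceil ≠ a[k + 1].ceil := by
  intro h
  rw [unprimeWord, ← List.take_append_drop k a, List.drop_eq_getElem_cons (by omega),
    List.drop_eq_getElem_cons hk, List.map_append, List.map_cons, List.map_cons, h] at hred
  exact InvReduced.not_append_cons_cons _ _ _ hred

/-- Proposition 3.18: `Des(a) = Des(Q_EGᴼ(a))` for every primed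
involution word `a`. -/
theorem stmt7 (z : Equiv.Perm ℤ) (hz : IZ z) (a : PWord) (ha : a ∈ RinvPlus z) :
    DesWord a = DesT (QEG a) := by
  have hred : InvReduced (unprimeWord a) := fun b hb => ha.1.2 b (hb.trans ha.1.1)
  choose! n B rest e U K hins using fun k (hk : k < a.length) => exists_isInsertion_PEG hred hk
  ext i
  rw [mem_DesT_QEG_iff (R := fun k => min (e k) (K k (e k))) (C := fun k => max (e k) (K k (e k)))
    (F := fun k => if hk : k < a.length then (egInsert (PEG (a.take k)) a[k]).2 else false)
    (fun k hk => PEG_take_succ hk ▸ (hins k hk).addsBox) (fun k hk => by rw [dif_pos hk])]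
  refine exists_congr fun k => and_congr_right fun _ => ?_
  by_cases hk : k + 1 < a.length
  swap
  · simp [hk]
  have hk' : k < a.length := by omega
  have hne := ceil_getElem_ne_ceil_getElem_succ hred hk
  have h := hins k hk'
  have h' := hins (k + 1) hk
  have hpath := h.path
  rw [← PEG_take_succ hk'] at hpath
  have hu := h.start
  have hv := h'.start
  have hword : (∃ x y, a[k]? = some x ∧ a[k + 1]? = some y ∧ y < x) ↔
      a[k + 1].ceil < a[k].ceil := by
    simp [List.getElem?_eq_getElem hk', List.getElem?_eq_getElem hk, Letter.lt_iff_ceil_lt hne.symm]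
  simp only [hword, hk', hk, dite_true, true_and]
  have h1 := h.last_le
  have h2 := h.le_last
  have h3 := h'.last_le
  have h4 := h'.le_last
  generalize (egInsert (PEG (a.take k)) a[k]).2 = b at h1 h2 ⊢
  generalize (egInsert (PEG (a.take (k + 1))) a[k + 1]).2 = b' at h3 h4 ⊢
  rcases lt_or_gt_of_ne hne with hlt | hlt
  · have h5 := hpath.le_and_lt_of_lt h'.path (by rw [hu, hv]; exact_mod_cast hlt)
    cases b <;> cases b' <;> simp at h1 h2 h3 h4 ⊢ <;> omega
  · have h5 := hpath.lt_and_le_of_gt h'.path (by rw [hu, hv]; exact_mod_cast hlt)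
    cases b <;> cases b' <;> simp at h1 h2 h3 h4 ⊢ <;> omega
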